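/- arXiv:1305.7418 — 7 statements merged into one kernel-verified Lean document; each statement's English description precedes it below -/
import Mathlib

section
/- Let A be a finite nontrivial multiset of real numbers with drift δ(A) ≥ 0. Then the growth constant of the sequence counting half-line walks on A equals the cardinality of A: K_A = |A| (cardinality counted with multiplicity). -/
open scoped BigOperators

/-- `w` is a half-line walk: every partial sum of its steps is nonnegative.
The steps of the (indexed) finite multiset `A` are chosen with multiplicity via the index. -/
def IsHalfLineWalk {ι : Type} (A : ι → ℝ) {n : ℕ} (w : Fin n → ι) : Prop :=
  ∀ m : Fin n, 0 ≤ ∑ i : Fin n, if i ≤ m then A (w i) else 0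

/-- `h_n(A)`: the number of half-line walks of length `n` on the finite multiset `A`. -/
noncomputable def hlineCount {ι : Type} [Fintype ι] (A : ι → ℝ) (n : ℕ) : ℕ :=
  Nat.card {w : Fin n → ι // IsHalfLineWalk A w}

/-- The growth constant `limsup h_n^{1/n}` of a counting sequence. -/
noncomputable def walkGrowth (h : ℕ → ℕ) : ℝ :=
  Filter.limsup (fun n => (h n : ℝ) ^ ((n : ℝ)⁻¹)) Filter.atTop

/-- The inventory `χ_A(u) = ∑_{a ∈ A} u^a` of a finite multiset of reals. -/
noncomputable def chi {ι : Type} [Fintype ι] (A : ι → ℝ) (u : ℝ) : ℝ :=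
  ∑ k, u ^ A k

open Finset Filter Topology
open scoped Nat

/-- Replacing `k !` by `c !` costs at least the factor `k ^ c / k ^ k`. -/
lemma factorial_mul_pow_le_factorial_mul_pow (k c : ℕ) : k ! * k ^ c ≤ c ! * k ^ k := by
  rcases le_total k c with h | h
  · obtain ⟨d, rfl⟩ := Nat.exists_eq_add_of_le h
    have h1 : k ! * k ^ d ≤ (k + d)! :=
      (Nat.mul_le_mul_left _ (Nat.pow_le_pow_left (Nat.le_succ k) d)).trans
        Nat.factorial_mul_pow_le_factorial
    calc k ! * k ^ (k + d) = k ! * k ^ d * k ^ k := by ring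
      _ ≤ _ := Nat.mul_le_mul_right _ h1
  · obtain ⟨d, rfl⟩ := Nat.exists_eq_add_of_le h
    have h1 : (c + d)! ≤ c ! * (c + d) ^ d := by
      rw [← Nat.factorial_mul_ascFactorial]
      exact Nat.mul_le_mul_left _ (Nat.ascFactorial_le_pow_add c d)
    calc (c + d)! * (c + d) ^ c ≤ c ! * (c + d) ^ d * (c + d) ^ c := Nat.mul_le_mul_right _ h1
      _ = _ := by ring

/-- Among products of factorials with a prescribed sum of arguments, the balanced one is the
smallest. -/
lemma factorial_pow_card_le_prod_factorial {ι : Type*} [Fintype ι] {k : ℕ} (hk : 0 < k)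
    (c : ι → ℕ) (hc : ∑ i, c i = Fintype.card ι * k) :
    k ! ^ Fintype.card ι ≤ ∏ i, (c i)! := by
  have h : ∏ i, k ! * k ^ c i ≤ ∏ i, (c i)! * k ^ k :=
    prod_le_prod' fun i _ => factorial_mul_pow_le_factorial_mul_pow k (c i)
  rw [prod_mul_distrib, prod_mul_distrib, prod_pow_eq_pow_sum, hc] at h
  simp only [prod_const, card_univ, ← pow_mul] at h
  rw [mul_comm k] at h
  exact Nat.le_of_mul_le_mul_right h (pow_pos hk _)

/-- The balanced multinomial coefficient is at least the average one. -/
lemma card_pow_mul_factorial_pow_le {ι : Type*} [Fintype ι] {k : ℕ} (hk : 0 < k) :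
    Fintype.card ι ^ (Fintype.card ι * k) * k ! ^ Fintype.card ι ≤
      (Fintype.card ι * k + 1) ^ Fintype.card ι * (Fintype.card ι * k)! := by
  classical
  set n := Fintype.card ι * k with hn
  have hsum := sum_pow_eq_sum_piAntidiag (univ : Finset ι) (fun _ => 1) n
  simp only [sum_const, card_univ, smul_eq_mul, mul_one, one_pow, prod_const_one, Nat.cast_id]
    at hsum
  have hcard : #(piAntidiag (univ : Finset ι) n) ≤ (n + 1) ^ Fintype.card ι := by
    have hsub : piAntidiag (univ : Finset ι) n ⊆ Fintype.piFinset fun _ => range (n + 1) := by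
      intro c hc
      rw [mem_piAntidiag] at hc
      rw [Fintype.mem_piFinset]
      intro i
      rw [mem_range, Nat.lt_succ_iff, ← hc.1]
      exact single_le_sum (fun _ _ => Nat.zero_le _) (mem_univ i)
    simpa using card_le_card hsub
  rw [hsum, sum_mul]
  refine (sum_le_card_nsmul _ _ n ! fun c hc => ?_).trans ?_
  · rw [mem_piAntidiag] at hc
    calc Nat.multinomial univ c * k ! ^ Fintype.card ι
        ≤ Nat.multinomial univ c * ∏ i, (c i)! :=
          Nat.mul_le_mul_left _ (factorial_pow_card_le_prod_factorial hk c hc.1)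
      _ = n ! := by rw [mul_comm, Nat.multinomial_spec, hc.1]
  · exact Nat.mul_le_mul_right _ hcard

/-- There are many words with nonnegative sum, since every word that uses each letter equally
often is one of them. -/
lemma factorial_le_card_sum_nonneg {ι : Type*} [Fintype ι] (A : ι → ℝ) (hA : 0 ≤ ∑ i, A i)
    (k : ℕ) :
    (Fintype.card ι * k)! ≤ k ! ^ Fintype.card ι *
      Nat.card {w : Fin (Fintype.card ι * k) → ι // 0 ≤ ∑ i, A (w i)} := by
  classical
  set n := Fintype.card ι * k with hn
  let e : Fin n ≃ ι × Fin k := (Fintype.equivFinOfCardEq (by simp [hn])).symm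
  let f : Fin n → ι := fun i => (e i).1
  have hfiber (i : ι) : Fintype.card {a // f a = i} = k := by
    rw [Fintype.card_congr (e.subtypeEquiv (q := fun p => p.1 = i) fun _ => Iff.rfl),
      Fintype.card_congr (Equiv.prodSubtypeFstEquivSubtypeProd (p := fun a => a = i))]
    simp
  have hstab : #{g : Equiv.Perm (Fin n) | f ∘ g = f} = k ! ^ Fintype.card ι := by
    rw [← Fintype.card_subtype, DomMulAct.stabilizer_card]
    simp [hfiber]
  have hf : ∑ i, A (f i) = k * ∑ i, A i := by
    rw [e.sum_comp fun p => A p.1, Fintype.sum_prod_type]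
    simp [mul_sum]
  have key := card_le_mul_card_image_of_maps_to
    (s := (univ : Finset (Equiv.Perm (Fin n))))
    (t := ({w | 0 ≤ ∑ i, A (w i)} : Finset (Fin n → ι))) (f := fun g : Equiv.Perm (Fin n) => f ∘ g)
    (fun g _ => by
      simp only [mem_filter, mem_univ, true_and, Function.comp_apply]
      rw [Equiv.sum_comp g fun i => A (f i), hf]
      positivity) (k ! ^ Fintype.card ι) (fun w _ => by
      by_cases hw : ∃ g₀ : Equiv.Perm (Fin n), f ∘ g₀ = w
      · obtain ⟨g₀, rfl⟩ := hw
        rw [← hstab]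
        refine card_le_card_of_injOn (fun g : Equiv.Perm (Fin n) => g * g₀⁻¹) (fun g hg => ?_)
          (mul_left_injective g₀⁻¹).injOn
        simp only [coe_filter, mem_univ, true_and, Set.mem_ofPred_eq] at hg ⊢
        rw [Equiv.Perm.coe_mul, ← Function.comp_assoc, hg, Function.comp_assoc,
          ← Equiv.Perm.coe_mul]
        simp
      · rw [filter_false_of_mem fun g _ hg => hw ⟨g, hg⟩]
        simp)
  rw [card_univ, Fintype.card_perm, Fintype.card_fin] at key
  rwa [Nat.card_eq_fintype_card, Fintype.card_subtype]

/-- The cycle lemma: a finite sequence with nonnegative sum has a rotation all of whose partial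
sums are nonnegative. -/
lemma exists_rotation_partial_sums_nonneg {n : ℕ} [NeZero n] (a : Fin n → ℝ)
    (ha : 0 ≤ ∑ i, a i) :
    ∃ r : Fin n, ∀ m : Fin n, 0 ≤ ∑ i : Fin n, if i ≤ m then a (i + r) else 0 := by
  let b : ℕ → ℝ := fun j => a (Fin.ofNat n j)
  let S : ℕ → ℝ := fun x => ∑ j ∈ range x, b j
  have hSn : S n = ∑ i, a i := by
    simp only [S, b]
    rw [← Fin.sum_univ_eq_sum_range (fun j => a (Fin.ofNat n j))]
    simp
  have hadd (x : ℕ) : S (n + x) = S n + S x := by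
    simp only [S, sum_range_add, b]
    congr 2
    ext j
    congr 1
    simp [Fin.ext_iff]
  obtain ⟨r, -, hr⟩ := exists_min_image (univ : Finset (Fin n)) (fun i => S i) univ_nonempty
  have hmin (x : ℕ) : S r ≤ S x := by
    induction x using Nat.strong_induction_on with
    | _ x ih =>
      rcases lt_or_ge x n with hx | hx
      · exact hr ⟨x, hx⟩ (mem_univ _)
      · obtain ⟨y, rfl⟩ := Nat.exists_eq_add_of_le hx
        have := ih y (by have := NeZero.pos n; omega)
        rw [hadd, hSn]
        linarith
  refine ⟨r, fun m => ?_⟩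
  have hsum : (∑ i : Fin n, if i ≤ m then a (i + r) else 0) = S (r + (m + 1)) - S r := by
    have h1 (i : Fin n) : (if i ≤ m then a (i + r) else 0) =
        (fun j : ℕ => if j < (m : ℕ) + 1 then b (r + j) else 0) i := by
      have h2 : Fin.ofNat n (r + i) = i + r := by
        simp [Fin.ext_iff, Fin.val_add, add_comm]
      simp only [b, h2, Nat.lt_succ_iff, Fin.le_def]
    simp only [S]
    rw [sum_range_add, add_sub_cancel_left, sum_congr rfl fun i _ => h1 i,
      Fin.sum_univ_eq_sum_range (fun j : ℕ => if j < (m : ℕ) + 1 then b (r + j) else 0),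
      ← sum_filter]
    refine sum_congr ?_ fun _ _ => rfl
    ext j
    have := m.isLt
    simp only [mem_filter, mem_range]
    omega
  rw [hsum, sub_nonneg]
  exact hmin _

/-- By the cycle lemma, at least one in `n` words with nonnegative sum is a half-line walk. -/
lemma card_sum_nonneg_le_mul_hlineCount {ι : Type} [Fintype ι] (A : ι → ℝ) {n : ℕ} (hn : 0 < n) :
    Nat.card {w : Fin n → ι // 0 ≤ ∑ i, A (w i)} ≤ n * hlineCount A n := by
  have : NeZero n := ⟨hn.ne'⟩
  choose r hr using fun w : {w : Fin n → ι // 0 ≤ ∑ i, A (w i)} =>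
    exists_rotation_partial_sums_nonneg (fun i => A (w.1 i)) w.2
  let F : {w : Fin n → ι // 0 ≤ ∑ i, A (w i)} → Fin n × {w : Fin n → ι // IsHalfLineWalk A w} :=
    fun w => (r w, ⟨fun i => w.1 (i + r w), hr w⟩)
  have hF : Function.Injective F := by
    intro w w' h
    simp only [F, Prod.mk.injEq] at h
    obtain ⟨h1, h2⟩ := h
    ext i
    have : w.1 (i - r w + r w) = w'.1 (i - r w + r w') :=
      congrFun (congrArg Subtype.val h2) (i - r w)
    rw [← h1] at this
    simpa using this
  simpa [Nat.card_prod, hlineCount] using Nat.card_le_card_of_injective F hF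

/-- Along the multiples of `|A|`, the number of half-line walks is at least the number of all walks
up to a polynomial factor. -/
lemma card_pow_le_mul_hlineCount {ι : Type} [Fintype ι] [Nonempty ι] (A : ι → ℝ)
    (hA : 0 ≤ ∑ i, A i) {n : ℕ} (hn : 0 < n) (hdvd : Fintype.card ι ∣ n) :
    Fintype.card ι ^ n ≤ (n + 1) ^ (Fintype.card ι + 1) * hlineCount A n := by
  obtain ⟨k, rfl⟩ := hdvd
  have hk : 0 < k := Nat.pos_of_mul_pos_left hn
  have h1 := card_pow_mul_factorial_pow_le (ι := ι) hk
  have h2 := factorial_le_card_sum_nonneg A hA k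
  have h3 := card_sum_nonneg_le_mul_hlineCount A hn
  set N := Fintype.card ι
  refine Nat.le_of_mul_le_mul_right (c := k ! ^ N) ?_ (pow_pos (Nat.factorial_pos k) _)
  calc N ^ (N * k) * k ! ^ N ≤ (N * k + 1) ^ N * (N * k)! := h1
    _ ≤ (N * k + 1) ^ N * (k ! ^ N * ((N * k + 1) * hlineCount A (N * k))) := by
      gcongr
      refine h2.trans ?_
      gcongr
      refine h3.trans ?_
      gcongr
      omega
    _ = _ := by ring

/-- There are at most `|A| ^ n` half-line walks of length `n`. -/
lemma hlineCount_le_card_pow {ι : Type} [Fintype ι] (A : ι → ℝ) (n : ℕ) :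
    hlineCount A n ≤ Fintype.card ι ^ n := by
  have := Nat.card_le_card_of_injective
    (Subtype.val : {w : Fin n → ι // IsHalfLineWalk A w} → Fin n → ι) Subtype.val_injective
  simpa [hlineCount] using this

/-- The `n`-th root of a power of `n + 1` tends to `1`. -/
lemma tendsto_add_one_rpow_div_atTop (d : ℝ) :
    Tendsto (fun n : ℕ => ((n : ℝ) + 1) ^ (d / n)) atTop (𝓝 1) := by
  have h := (tendsto_rpow_div_mul_add d 1 (-1) zero_ne_one).comp
    (tendsto_atTop_add_const_right atTop (1 : ℝ) tendsto_natCast_atTop_atTop)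
  refine h.congr fun n => ?_
  simp

/-- For a finite nontrivial multiset `A` of reals with drift `δ(A) ≥ 0`,
the growth constant of the half-line walk counting sequence equals `|A|`
(the cardinality counted with multiplicity). -/
theorem halfline_growth_of_nonneg_drift {ι : Type} [Fintype ι] (A : ι → ℝ)
    (hpos : ∃ k, 0 < A k) (hneg : ∃ k, A k < 0)
    (hdrift : 0 ≤ ∑ k, A k) :
    walkGrowth (hlineCount A) = Fintype.card ι := by
  have : Nonempty ι := ⟨hpos.choose⟩
  have hN : 0 < Fintype.card ι := Fintype.card_pos
  have hN1 : (1 : ℝ) ≤ Fintype.card ι := by exact_mod_cast hN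
  have hupper (n : ℕ) : (hlineCount A n : ℝ) ^ ((n : ℝ)⁻¹) ≤ Fintype.card ι := by
    rcases Nat.eq_zero_or_pos n with rfl | hn
    · simpa using hN1
    · calc (hlineCount A n : ℝ) ^ ((n : ℝ)⁻¹) ≤ ((Fintype.card ι : ℝ) ^ n) ^ ((n : ℝ)⁻¹) := by
            gcongr
            exact_mod_cast hlineCount_le_card_pow A n
        _ = Fintype.card ι := Real.pow_rpow_inv_natCast (by positivity) hn.ne'
  have hbdd : IsBoundedUnder (· ≤ ·) atTop fun n : ℕ => (hlineCount A n : ℝ) ^ ((n : ℝ)⁻¹) :=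
    isBoundedUnder_of ⟨_, hupper⟩
  refine le_antisymm (limsup_le_of_le ?_ (Eventually.of_forall hupper)) ?_
  · exact (isBoundedUnder_of ⟨0, fun n => by positivity⟩ :
      IsBoundedUnder (· ≥ ·) atTop _).isCoboundedUnder_le
  refine le_of_forall_lt fun b hb => ?_
  obtain ⟨c, hbc, hc⟩ := exists_between hb
  refine hbc.trans_le (le_limsup_of_frequently_le ?_ hbdd)
  have hlim : Tendsto (fun n : ℕ =>
      (Fintype.card ι : ℝ) / ((n : ℝ) + 1) ^ (((Fintype.card ι + 1 : ℕ) : ℝ) / n)) atTop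
      (𝓝 (Fintype.card ι / 1)) :=
    tendsto_const_nhds.div (tendsto_add_one_rpow_div_atTop _) one_ne_zero
  rw [div_one] at hlim
  have hfreq : ∃ᶠ n : ℕ in atTop, 0 < n ∧ Fintype.card ι ∣ n :=
    frequently_atTop.2 fun a => ⟨Fintype.card ι * (a + 1), by nlinarith, by positivity, by simp⟩
  refine (hfreq.and_eventually (hlim.eventually_const_lt hc)).mono ?_
  rintro n ⟨⟨hn, hdvd⟩, hcn⟩
  refine hcn.le.trans ?_
  have hmain : (Fintype.card ι : ℝ) ^ n ≤ ((n : ℝ) + 1) ^ (Fintype.card ι + 1) * hlineCount A n := by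
    exact_mod_cast card_pow_le_mul_hlineCount A hdrift hn hdvd
  rw [div_le_iff₀ (by positivity)]
  calc (Fintype.card ι : ℝ) = ((Fintype.card ι : ℝ) ^ n) ^ ((n : ℝ)⁻¹) :=
        (Real.pow_rpow_inv_natCast (by positivity) hn.ne').symm
    _ ≤ (((n : ℝ) + 1) ^ (Fintype.card ι + 1) * hlineCount A n) ^ ((n : ℝ)⁻¹) := by gcongr
    _ = _ := by
      rw [Real.mul_rpow (by positivity) (by positivity), mul_comm, div_eq_mul_inv,
        Real.rpow_mul (by positivity), Real.rpow_natCast]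
end

section
/- Let F : ℝ^ℓ × ℝ_{>0} → ℝ be defined by F(x, u) = Σ_{j=1}^{ℓ} u^{x_j}. Let a ∈ ℝ^ℓ have at least one positive component and at least one negative component. Then u ↦ F(a, u) has a unique positive critical point, and there exists an open neighbourhood U of a in ℝ^ℓ and a C^∞ function τ : U → (0,∞) such that for every x ∈ U, τ(x) is the unique positive solution of ∂F/∂u(x, τ(x)) = 0; consequently the function κ(x) = F(x, τ(x)) is C^∞ (smooth) on U. -/
open scoped BigOperators Topology

/-- The logarithmic derivative sum `∑ j, x j * exp (x j * t)`, that is `u ∂F/∂u` at `u = exp t`. -/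
noncomputable def expMoment {ι : Type*} [Fintype ι] (x : ι → ℝ) (t : ℝ) : ℝ :=
  ∑ j, x j * Real.exp (x j * t)

lemma isOpen_exists_pos_and_exists_neg {ι : Type*} :
    IsOpen {x : ι → ℝ | (∃ j, 0 < x j) ∧ ∃ j, x j < 0} := by
  simp only [Set.ofPred_and, Set.ofPred_exists]
  exact (isOpen_iUnion fun j => isOpen_lt continuous_const (continuous_apply j)).inter
    (isOpen_iUnion fun j => isOpen_lt (continuous_apply j) continuous_const)

section expMoment

variable {ι : Type*} [Fintype ι]

lemma deriv_sum_rpow_eq_zero_iff (x : ι → ℝ) {u : ℝ} (hu : 0 < u) :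
    deriv (fun u : ℝ => ∑ j, u ^ x j) u = 0 ↔ expMoment x (Real.log u) = 0 := by
  have h : HasDerivAt (fun u : ℝ => ∑ j, u ^ x j) (∑ j, x j * u ^ (x j - 1)) u :=
    HasDerivAt.fun_sum fun j _ => Real.hasDerivAt_rpow_const (Or.inl hu.ne')
  have h' : ∑ j, x j * u ^ (x j - 1) = expMoment x (Real.log u) / u := by
    rw [expMoment, Finset.sum_div]
    refine Finset.sum_congr rfl fun j _ => ?_
    rw [Real.rpow_sub_one hu.ne', Real.rpow_def_of_pos hu, mul_comm (Real.log u), mul_div_assoc]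
  rw [h.deriv, h', div_eq_zero_iff, or_iff_left hu.ne']

lemma hasDerivAt_expMoment (x : ι → ℝ) (t : ℝ) :
    HasDerivAt (expMoment x) (∑ j, x j ^ 2 * Real.exp (x j * t)) t := by
  refine HasDerivAt.fun_sum fun j _ => ?_
  have h := (hasDerivAt_const_mul (x j) (x := t)).exp.const_mul (x j)
  rwa [mul_left_comm, ← sq, mul_comm] at h

lemma sum_sq_mul_exp_pos {x : ι → ℝ} (hx : ∃ j, 0 < x j) (t : ℝ) :
    0 < ∑ j, x j ^ 2 * Real.exp (x j * t) := by
  obtain ⟨j, hj⟩ := hx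
  exact Finset.sum_pos' (fun i _ => by positivity) ⟨j, Finset.mem_univ j, by positivity⟩

lemma strictMono_expMoment {x : ι → ℝ} (hx : ∃ j, 0 < x j) : StrictMono (expMoment x) :=
  strictMono_of_hasDerivAt_pos (hasDerivAt_expMoment x) fun t => sum_sq_mul_exp_pos hx t

lemma exists_expMoment_nonneg {x : ι → ℝ} (hx : ∃ j, 0 < x j) : ∃ t, 0 ≤ expMoment x t := by
  classical
  obtain ⟨j, hj⟩ := hx
  set S := ∑ i, |x i| with hS
  have hS0 : 0 ≤ S := Finset.sum_nonneg fun i _ => abs_nonneg _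
  refine ⟨S / x j ^ 2, ?_⟩
  have ht : 0 ≤ S / x j ^ 2 := by positivity
  have hterm : ∀ i, (-|x i| + if i = j then S else 0) ≤ x i * Real.exp (x i * (S / x j ^ 2)) := by
    intro i
    split_ifs with hij
    · subst hij
      have h1 := Real.add_one_le_exp (x i * (S / x i ^ 2))
      have h2 := mul_le_mul_of_nonneg_left h1 hj.le
      have h3 : x i * (x i * (S / x i ^ 2) + 1) = S + x i := by field_simp
      have h4 := abs_nonneg (x i)
      linarith
    · rw [add_zero]
      rcases le_total 0 (x i) with h | h
      · exact (neg_nonpos.2 (abs_nonneg _)).trans (by positivity)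
      · have h1 : Real.exp (x i * (S / x j ^ 2)) ≤ 1 :=
          Real.exp_le_one_iff.2 (mul_nonpos_of_nonpos_of_nonneg h ht)
        rw [abs_of_nonpos h, neg_neg]
        nlinarith
  calc (0 : ℝ) = ∑ i, (-|x i| + if i = j then S else 0) := by
        simp [Finset.sum_add_distrib, hS]
    _ ≤ _ := Finset.sum_le_sum fun i _ => hterm i

lemma expMoment_neg (x : ι → ℝ) (t : ℝ) : expMoment (-x) (-t) = -expMoment x t := by
  simp [expMoment]

lemma exists_expMoment_eq_zero {x : ι → ℝ} (hpos : ∃ j, 0 < x j) (hneg : ∃ j, x j < 0) :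
    ∃ t, expMoment x t = 0 := by
  obtain ⟨t, ht⟩ := exists_expMoment_nonneg hpos
  obtain ⟨s, hs⟩ := exists_expMoment_nonneg (x := -x) (by simpa using hneg)
  have hs' : expMoment x (-s) ≤ 0 := by
    have := expMoment_neg x (-s)
    rw [neg_neg] at this
    linarith
  have hc : Continuous (expMoment x) :=
    continuous_iff_continuousAt.2 fun t => (hasDerivAt_expMoment x t).continuousAt
  exact mem_range_of_exists_le_of_exists_ge hc ⟨_, hs'⟩ ⟨_, ht⟩

lemma contDiff_uncurry_expMoment {n : WithTop ℕ∞} :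
    ContDiff ℝ n fun p : (ι → ℝ) × ℝ => expMoment p.1 p.2 := by
  unfold expMoment
  fun_prop

/-- A function selecting zeros of `expMoment` near `x` is smooth at `x`. -/
lemma contDiffAt_of_expMoment_eq_zero {x : ι → ℝ} (hx : ∃ j, 0 < x j)
    {σ : (ι → ℝ) → ℝ} (hσ : ∀ᶠ y in 𝓝 x, expMoment y (σ y) = 0) {n : WithTop ℕ∞} (hn : n ≠ 0) :
    ContDiffAt ℝ n σ x := by
  set f : (ι → ℝ) × ℝ → ℝ := fun p => expMoment p.1 p.2
  have hf : ContDiffAt ℝ n f (x, σ x) := contDiff_uncurry_expMoment.contDiffAt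
  have hc := (sum_sq_mul_exp_pos hx (σ x)).ne'
  set c := ∑ j, x j ^ 2 * Real.exp (x j * σ x)
  have hinv : (fderiv ℝ f (x, σ x) ∘L .inr ℝ (ι → ℝ) ℝ).IsInvertible := by
    have h1 : HasFDerivAt (fun t => f (x, t)) (fderiv ℝ f (x, σ x) ∘L .inr ℝ (ι → ℝ) ℝ) (σ x) :=
      (hf.differentiableAt hn).hasFDerivAt.comp (σ x) (hasFDerivAt_prodMk_right x (σ x))
    have h2 := (hasDerivAt_expMoment x (σ x)).hasFDerivAt
    rw [h1.unique h2]
    refine ⟨ContinuousLinearEquiv.unitsEquivAut ℝ (Units.mk0 c hc), ?_⟩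
    ext
    simp [c]
  have hpos : ∀ᶠ y : ι → ℝ in 𝓝 x, ∃ j, 0 < y j := by
    obtain ⟨j, hj⟩ := hx
    exact ((continuous_apply j).continuousAt.eventually (lt_mem_nhds hj)).mono fun y hy => ⟨j, hy⟩
  refine (hf.contDiffAt_implicitFunction hn hinv).congr_of_eventuallyEq ?_
  filter_upwards [hσ, hpos, hf.eventually_apply_implicitFunction hn hinv] with y hy hy' hψ
  exact (strictMono_expMoment hy').injective (hy.trans (hσ.self_of_nhds.symm.trans hψ.symm))

end expMoment

/-- Let `F(x,u) = ∑_{j=1}^ℓ u^{x_j}` for `x ∈ ℝ^ℓ` and `u > 0`.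
If `a ∈ ℝ^ℓ` has at least one positive and one negative component, then `u ↦ F(a,u)`
has a unique positive critical point, and there is an open neighbourhood `U` of `a`
and a `C^∞` function `τ : U → (0,∞)` such that for every `x ∈ U`, `τ(x)` is the unique
positive solution of `∂F/∂u(x, τ(x)) = 0`; consequently `κ(x) = F(x, τ(x))` is `C^∞`
on `U`. -/
theorem smooth_critical_value {ℓ : ℕ} (a : Fin ℓ → ℝ)
    (hpos : ∃ j, 0 < a j) (hneg : ∃ j, a j < 0) :
    (∃! u : ℝ, 0 < u ∧ deriv (fun u : ℝ => ∑ j, u ^ a j) u = 0) ∧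
    ∃ (U : Set (Fin ℓ → ℝ)) (τ : (Fin ℓ → ℝ) → ℝ),
      IsOpen U ∧ a ∈ U ∧ ContDiffOn ℝ (⊤ : ℕ∞) τ U ∧
      (∀ x ∈ U, 0 < τ x ∧ deriv (fun u : ℝ => ∑ j, u ^ x j) (τ x) = 0 ∧
        (∀ u : ℝ, 0 < u → deriv (fun u : ℝ => ∑ j, u ^ x j) u = 0 → u = τ x)) ∧
      ContDiffOn ℝ (⊤ : ℕ∞) (fun x => ∑ j, τ x ^ x j) U := by
  set U := {x : Fin ℓ → ℝ | (∃ j, 0 < x j) ∧ ∃ j, x j < 0}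
  have hU : IsOpen U := isOpen_exists_pos_and_exists_neg
  have hex : ∀ x : Fin ℓ → ℝ, ∃ t, x ∈ U → expMoment x t = 0 := fun x => by
    by_cases hx : x ∈ U
    · obtain ⟨t, ht⟩ := exists_expMoment_eq_zero hx.1 hx.2
      exact ⟨t, fun _ => ht⟩
    · exact ⟨0, fun h => absurd h hx⟩
  choose σ hσ using hex
  have hcrit : ∀ x ∈ U, 0 < Real.exp (σ x) ∧
      deriv (fun u : ℝ => ∑ j, u ^ x j) (Real.exp (σ x)) = 0 ∧
      ∀ u : ℝ, 0 < u → deriv (fun u : ℝ => ∑ j, u ^ x j) u = 0 → u = Real.exp (σ x) := by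
    refine fun x hx => ⟨Real.exp_pos _, ?_, fun u hu h => ?_⟩
    · rw [deriv_sum_rpow_eq_zero_iff x (Real.exp_pos _), Real.log_exp, hσ x hx]
    · rw [deriv_sum_rpow_eq_zero_iff x hu] at h
      rw [← (strictMono_expMoment hx.1).injective (h.trans (hσ x hx).symm), Real.exp_log hu]
  have hsmooth : ContDiffOn ℝ (⊤ : ℕ∞) σ U := fun x hx =>
    (contDiffAt_of_expMoment_eq_zero hx.1
      ((hU.eventually_mem hx).mono fun y hy => hσ y hy) (by simp)).contDiffWithinAt
  have haU : a ∈ U := ⟨hpos, hneg⟩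
  refine ⟨⟨Real.exp (σ a), ⟨(hcrit a haU).1, (hcrit a haU).2.1⟩,
    fun u hu => (hcrit a haU).2.2 u hu.1 hu.2⟩,
    U, fun x => Real.exp (σ x), hU, haU, hsmooth.exp, hcrit, ?_⟩
  simp only [← Real.exp_mul]
  fun_prop
end

section
/- Let S ⊂ ℤ² be a finite multiset defining a nontrivial quarter-plane model with inventory P(x,y) = Σ_{(i,j)∈S} x^i y^j, and suppose (α, β) ∈ (0,∞)² is the unique positive critical point of P with β ≠ 1 and log α / log β < 0. Then the minimum of K_S(θ) over θ ∈ [0, π/2] is attained at an endpoint: min_{θ∈[0,π/2]} K_S(θ) equals K_S(0) or K_S(π/2). -/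
open scoped BigOperators

/-- `w` is a walk on the step multiset `S` staying in the region `R`:
every partial sum of its steps lies in `R`. -/
def IsWalkIn {ι : Type} (S : ι → ℤ × ℤ) (R : Set (ℝ × ℝ)) {n : ℕ} (w : Fin n → ι) : Prop :=
  ∀ m : Fin n,
    ((∑ i : Fin n, if i ≤ m then ((S (w i)).1 : ℝ) else 0),
     (∑ i : Fin n, if i ≤ m then ((S (w i)).2 : ℝ) else 0)) ∈ R

/-- The number of walks of length `n` on `S` staying in the region `R`. -/
noncomputable def walkCount {ι : Type} [Fintype ι] (S : ι → ℤ × ℤ) (R : Set (ℝ × ℝ))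
    (n : ℕ) : ℕ :=
  Nat.card {w : Fin n → ι // IsWalkIn S R w}

/-- The half-plane `H_θ = {(x,y) : x sin θ + y cos θ ≥ 0}`. -/
def Hplane (θ : ℝ) : Set (ℝ × ℝ) := {p | 0 ≤ p.1 * Real.sin θ + p.2 * Real.cos θ}

/-- The first quadrant `Q = [0,∞)²`. -/
def Quadrant : Set (ℝ × ℝ) := {p : ℝ × ℝ | 0 ≤ p.1 ∧ 0 ≤ p.2}

/-- The projected unidimensional multiset `A(θ) = {i sin θ + j cos θ : (i,j) ∈ S}`. -/
noncomputable def Atheta {ι : Type} (S : ι → ℤ × ℤ) (θ : ℝ) : ι → ℝ :=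
  fun k => ((S k).1 : ℝ) * Real.sin θ + ((S k).2 : ℝ) * Real.cos θ

/-- The inventory Laurent polynomial `P(x,y) = ∑_{(i,j) ∈ S} x^i y^j`. -/
noncomputable def Pinv {ι : Type} [Fintype ι] (S : ι → ℤ × ℤ) (x y : ℝ) : ℝ :=
  ∑ k, x ^ (S k).1 * y ^ (S k).2

/-- A quarter-plane model is nontrivial: it has a walk of positive length staying in the
quadrant, and for each of the two boundary half-axes some walk staying in the quadrant
touches that boundary. -/
def NontrivialQP {ι : Type} (S : ι → ℤ × ℤ) : Prop :=
  (∃ n : ℕ, 0 < n ∧ ∃ w : Fin n → ι, IsWalkIn S Quadrant w) ∧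
  (∃ (n : ℕ) (w : Fin n → ι), IsWalkIn S Quadrant w ∧
     ∃ m : Fin n, (∑ i : Fin n, if i ≤ m then ((S (w i)).2 : ℝ) else 0) = 0) ∧
  (∃ (n : ℕ) (w : Fin n → ι), IsWalkIn S Quadrant w ∧
     ∃ m : Fin n, (∑ i : Fin n, if i ≤ m then ((S (w i)).1 : ℝ) else 0) = 0)

open Filter Topology Real Finset

/-- The sum of the steps of a word. -/
noncomputable def wordSum {ι : Type} (A : ι → ℝ) {n : ℕ} (w : Fin n → ι) : ℝ :=
  ∑ i, A (w i)

/-- The exponential moment sum of a finite multiset of reals. -/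
noncomputable def expSum {ι : Type} [Fintype ι] (A : ι → ℝ) (r : ℝ) : ℝ :=
  ∑ k, exp (r * A k)

lemma expSum_nonneg {ι : Type} [Fintype ι] (A : ι → ℝ) (r : ℝ) : 0 ≤ expSum A r :=
  Finset.sum_nonneg fun _ _ => (exp_pos _).le

lemma sum_exp_wordSum {ι : Type} [Fintype ι] (A : ι → ℝ) (r : ℝ) (n : ℕ) :
    ∑ w : Fin n → ι, exp (r * wordSum A w) = expSum A r ^ n := by
  classical
  simp only [expSum, wordSum, Finset.mul_sum, Real.exp_sum]
  rw [Fintype.sum_pow]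

lemma isWalkIn_Hplane_iff {ι : Type} (S : ι → ℤ × ℤ) (θ : ℝ) {n : ℕ} (w : Fin n → ι) :
    IsWalkIn S (Hplane θ) w ↔ IsHalfLineWalk (Atheta S θ) w := by
  simp only [IsWalkIn, IsHalfLineWalk, Hplane, Set.mem_ofPred_eq, Atheta, Finset.sum_mul,
    ← Finset.sum_add_distrib]
  refine forall_congr' fun m => ?_
  refine iff_of_eq (congrArg _ (Finset.sum_congr rfl fun i _ => ?_))
  split_ifs <;> simp

lemma walkCount_Hplane {ι : Type} [Fintype ι] (S : ι → ℤ × ℤ) (θ : ℝ) :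
    walkCount S (Hplane θ) = hlineCount (Atheta S θ) := by
  ext n
  simp only [walkCount, hlineCount, isWalkIn_Hplane_iff]

lemma IsHalfLineWalk.wordSum_nonneg {ι : Type} {A : ι → ℝ} {n : ℕ} {w : Fin n → ι}
    (h : IsHalfLineWalk A w) : 0 ≤ wordSum A w := by
  cases n with
  | zero => simp [wordSum]
  | succ n => simpa [wordSum, Fin.le_last] using h (Fin.last n)

lemma hlineCount_le {ι : Type} [Fintype ι] (A : ι → ℝ) {r : ℝ} (hr : 0 ≤ r) (n : ℕ) :
    (hlineCount A n : ℝ) ≤ expSum A r ^ n := by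
  classical
  rw [← sum_exp_wordSum, hlineCount, Nat.card_eq_fintype_card, Fintype.card_subtype,
    Finset.card_eq_sum_ones, Nat.cast_sum]
  refine (Finset.sum_le_sum fun w hw => ?_).trans
    (Finset.sum_le_sum_of_subset_of_nonneg (Finset.filter_subset _ _)
      fun _ _ _ => (exp_pos _).le)
  have := (Finset.mem_filter.1 hw).2.wordSum_nonneg
  simpa using mul_nonneg hr this

lemma hlineCount_rpow_le {ι : Type} [Fintype ι] (A : ι → ℝ) {r : ℝ} (hr : 0 ≤ r) {n : ℕ}
    (hn : n ≠ 0) : (hlineCount A n : ℝ) ^ ((n : ℝ)⁻¹) ≤ expSum A r := by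
  calc (hlineCount A n : ℝ) ^ ((n : ℝ)⁻¹) ≤ (expSum A r ^ n) ^ ((n : ℝ)⁻¹) :=
        Real.rpow_le_rpow (Nat.cast_nonneg _) (hlineCount_le A hr n) (by positivity)
    _ = expSum A r := Real.pow_rpow_inv_natCast (expSum_nonneg A r) hn

lemma walkGrowth_hlineCount_le {ι : Type} [Fintype ι] (A : ι → ℝ) {r : ℝ} (hr : 0 ≤ r) :
    walkGrowth (hlineCount A) ≤ expSum A r := by
  refine limsup_le_of_le ?_ ?_
  · exact isCoboundedUnder_le_of_le atTop (x := 0) fun n => by positivity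
  · filter_upwards [eventually_ne_atTop 0] with n hn using hlineCount_rpow_le A hr hn

/-- Above the growth constant, the counting sequence is eventually dominated geometrically. -/
lemma eventually_hlineCount_le_pow {ι : Type} [Fintype ι] (A : ι → ℝ) {ρ : ℝ}
    (h : walkGrowth (hlineCount A) < ρ) : ∀ᶠ n in atTop, (hlineCount A n : ℝ) ≤ ρ ^ n := by
  have hb : IsBoundedUnder (· ≤ ·) atTop
      (fun n : ℕ => (hlineCount A n : ℝ) ^ ((n : ℝ)⁻¹)) :=
    isBoundedUnder_of_eventually_le (a := expSum A 0) <| by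
      filter_upwards [eventually_ne_atTop 0] with n hn using hlineCount_rpow_le A le_rfl hn
  filter_upwards [eventually_lt_of_limsup_lt h hb, eventually_ne_atTop 0] with n hn hn0
  calc (hlineCount A n : ℝ) = ((hlineCount A n : ℝ) ^ ((n : ℝ)⁻¹)) ^ n :=
        (Real.rpow_inv_natCast_pow (Nat.cast_nonneg _) hn0).symm
    _ ≤ ρ ^ n := pow_le_pow_left₀ (by positivity) hn.le n

lemma walkGrowth_hlineCount_nonneg {ι : Type} [Fintype ι] (A : ι → ℝ) :
    0 ≤ walkGrowth (hlineCount A) := by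
  by_contra! h
  obtain ⟨ρ, h1, h2⟩ := exists_between h
  obtain ⟨n, hn, hodd⟩ := ((eventually_hlineCount_le_pow A h1).and_frequently
    (Filter.frequently_atTop.2 fun N => ⟨2 * N + 1, by omega, odd_two_mul_add_one N⟩)).exists
  exact absurd (hodd.pow_neg h2) (not_lt.2 ((Nat.cast_nonneg _).trans hn))

lemma sum_ite_le_eq_sum_range {n : ℕ} (f : ℕ → ℝ) (m : Fin n) :
    ∑ i : Fin n, (if i ≤ m then f i else 0) = ∑ i ∈ range (m + 1), f i := by
  have := Fin.sum_univ_eq_sum_range (fun i => if i ≤ (m : ℕ) then f i else 0) n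
  simp only [Fin.le_def]
  rw [this, ← Finset.sum_filter]
  congr 1
  ext i
  simp only [mem_filter, mem_range]
  omega

/-- The cycle lemma: a word of nonnegative sum has a cyclic rotation which is a half-line walk. -/
lemma exists_rotation_isHalfLineWalk {ι : Type} (A : ι → ℝ) {n : ℕ} [NeZero n] (w : Fin n → ι)
    (hw : 0 ≤ wordSum A w) : ∃ j : Fin n, IsHalfLineWalk A fun i => w (i + j) := by
  set f : ℕ → ℝ := fun i => A (w (Fin.ofNat n i)) with hf
  set s : ℕ → ℝ := fun m => ∑ i ∈ range m, f i with hs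
  have hsn : 0 ≤ s n := by
    have := Fin.sum_univ_eq_sum_range f n
    simp only [hf, Fin.ofNat_val_eq_self] at this
    exact hw.trans_eq this
  have hper (m : ℕ) : s (n + m) = s n + s m := by
    simp only [hs, Finset.sum_range_add]
    congr 1
    refine Finset.sum_congr rfl fun i _ => ?_
    simp [hf, Fin.ofNat]
  obtain ⟨j, -, hj⟩ := Finset.exists_min_image (univ : Finset (Fin n)) (fun j => s j)
    ⟨0, mem_univ _⟩
  have hmin (m : ℕ) (hm : m ≤ 2 * n) : s j ≤ s m := by
    have h0 : ∀ k < n, s j ≤ s k := fun k hk => hj ⟨k, hk⟩ (mem_univ _)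
    have hn : 0 < n := Nat.pos_of_ne_zero (NeZero.ne n)
    have h00 : s 0 = 0 := by simp [hs]
    have h1 := h0 0 hn
    rcases lt_or_ge m n with h | h
    · exact h0 m h
    · obtain ⟨k, rfl⟩ := Nat.exists_eq_add_of_le h
      rw [hper]
      rcases lt_or_ge k n with h' | h'
      · linarith [h0 k h']
      · obtain rfl : k = n := by omega
        linarith
  refine ⟨j, fun m => ?_⟩
  have key (i : Fin n) : A (w (i + j)) = f (j + i) := by
    simp only [hf]
    congr 2
    ext
    simp [Fin.val_add, Fin.ofNat, add_comm]
  simp only [key]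
  rw [sum_ite_le_eq_sum_range (fun i => f (j + i)) m]
  have := Finset.sum_range_add f j (m + 1)
  have h2 := hmin (j + (m + 1)) (by omega)
  simp only [hs] at h2
  linarith

lemma card_wordSum_nonneg_le {ι : Type} [Fintype ι] (A : ι → ℝ) {n : ℕ} (hn : n ≠ 0) :
    Nat.card {w : Fin n → ι // 0 ≤ wordSum A w} ≤ n * hlineCount A n := by
  classical
  have : NeZero n := ⟨hn⟩
  choose j hj using fun w : {w : Fin n → ι // 0 ≤ wordSum A w} =>
    exists_rotation_isHalfLineWalk A w.1 w.2
  have hinj : Function.Injective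
      (fun w => (j w, ⟨_, hj w⟩) : {w : Fin n → ι // 0 ≤ wordSum A w} →
        Fin n × {w : Fin n → ι // IsHalfLineWalk A w}) := by
    intro u v huv
    simp only [Prod.mk.injEq, Subtype.mk.injEq] at huv
    obtain ⟨h1, h2⟩ := huv
    refine Subtype.ext (funext fun i => ?_)
    have := congrFun h2 (i - j u)
    simpa [h1] using this
  have := Nat.card_le_card_of_injective _ hinj
  rwa [Nat.card_prod, Nat.card_fin] at this

/-- Splitting an exponential moment according to whether the sum is negative, larger than
`η n`, or in between. -/
lemma expSum_pow_le {ι : Type} [Fintype ι] (A : ι → ℝ) {r η t t' : ℝ} (hr : 0 ≤ r)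
    (ht : 0 ≤ t) (ht' : 0 ≤ t') (n : ℕ) :
    expSum A r ^ n ≤ expSum A (r - t) ^ n + (expSum A (r + t') * exp (-(t' * η))) ^ n +
      Nat.card {w : Fin n → ι // 0 ≤ wordSum A w} * exp (r * η) ^ n := by
  classical
  rw [mul_pow, ← sum_exp_wordSum, ← sum_exp_wordSum, ← sum_exp_wordSum,
    Nat.card_eq_fintype_card, Fintype.card_subtype, Finset.card_eq_sum_ones, Finset.sum_filter,
    Nat.cast_sum, Finset.sum_mul, Finset.sum_mul, ← Finset.sum_add_distrib,
    ← Finset.sum_add_distrib]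
  refine Finset.sum_le_sum fun w _ => ?_
  rw [← Real.exp_nat_mul, ← Real.exp_nat_mul, ← Real.exp_add]
  set x := wordSum A w
  have h1 := exp_pos ((r - t) * x)
  have h2 := exp_pos ((r + t') * x + n * (-(t' * η)))
  have h3 := exp_pos (n * (r * η))
  rcases lt_or_ge x 0 with hx | hx
  · have : exp (r * x) ≤ exp ((r - t) * x) := exp_le_exp.2 (by nlinarith)
    rw [if_neg (not_le.2 hx), Nat.cast_zero, zero_mul]
    linarith
  · rw [if_pos hx, Nat.cast_one, one_mul]
    rcases le_or_gt x (n * η) with h | h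
    · have : exp (r * x) ≤ exp (n * (r * η)) := exp_le_exp.2 (by nlinarith)
      linarith
    · have : exp (r * x) ≤ exp ((r + t') * x + n * (-(t' * η))) := exp_le_exp.2 (by nlinarith)
      linarith

lemma expSum_le_mul_exp {ι : Type} [Fintype ι] (A : ι → ℝ) {r η t t' ρ : ℝ} (hr : 0 ≤ r)
    (ht : 0 ≤ t) (ht' : 0 ≤ t') (hρ : walkGrowth (hlineCount A) < ρ)
    (h1 : expSum A (r - t) < expSum A r)
    (h2 : expSum A (r + t') * exp (-(t' * η)) < expSum A r) :
    expSum A r ≤ ρ * exp (r * η) := by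
  by_contra! h3
  have hρ0 : 0 ≤ ρ := (walkGrowth_hlineCount_nonneg A).trans hρ.le
  have hF : 0 < expSum A r := (expSum_nonneg A _).trans_lt h1
  have l1 := tendsto_pow_atTop_nhds_zero_of_lt_one
    (div_nonneg (expSum_nonneg A (r - t)) hF.le) ((div_lt_one hF).2 h1)
  have l2 := tendsto_pow_atTop_nhds_zero_of_lt_one
    (div_nonneg (mul_nonneg (expSum_nonneg A (r + t')) (exp_pos (-(t' * η))).le) hF.le)
    ((div_lt_one hF).2 h2)
  have l3 := tendsto_self_mul_const_pow_of_lt_one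
    (div_nonneg (mul_nonneg hρ0 (exp_pos (r * η)).le) hF.le) ((div_lt_one hF).2 h3)
  have l := (l1.add l2).add l3
  rw [add_zero, add_zero] at l
  obtain ⟨n, hlt, hn, hn0⟩ := ((l.eventually_lt_const one_pos).and
    ((eventually_hlineCount_le_pow A hρ).and (eventually_ne_atTop 0))).exists
  have hcard : (Nat.card {w : Fin n → ι // 0 ≤ wordSum A w} : ℝ) ≤ n * ρ ^ n :=
    calc _ ≤ ((n * hlineCount A n : ℕ) : ℝ) := by exact_mod_cast card_wordSum_nonneg_le A hn0
      _ ≤ n * ρ ^ n := by push_cast; gcongr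
  have hsplit := expSum_pow_le A (η := η) hr ht ht' n
  have hFn : 0 < expSum A r ^ n := pow_pos hF n
  rw [div_pow, div_pow, div_pow, ← mul_div_assoc, ← add_div, ← add_div, div_lt_one hFn] at hlt
  have : (Nat.card {w : Fin n → ι // 0 ≤ wordSum A w} : ℝ) * exp (r * η) ^ n
      ≤ n * (ρ * exp (r * η)) ^ n := by
    rw [mul_pow ρ, ← mul_assoc]
    gcongr
  linarith

lemma hasDerivAt_expSum {ι : Type} [Fintype ι] (A : ι → ℝ) (r : ℝ) :
    HasDerivAt (expSum A) (∑ k, A k * exp (r * A k)) r := by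
  unfold expSum
  refine HasDerivAt.fun_sum fun k _ => ?_
  simpa [mul_comm] using ((hasDerivAt_id r).mul_const (A k)).exp

lemma exists_pos_lt_of_hasDerivAt_neg {f : ℝ → ℝ} {f' : ℝ} (hf : HasDerivAt f f' 0)
    (hf' : f' < 0) : ∃ t > 0, f t < f 0 := by
  have h := hf.tendsto_slope_zero_right.eventually_lt_const hf'
  obtain ⟨t, ht, ht0⟩ := (h.and self_mem_nhdsWithin).exists
  refine ⟨t, ht0, ?_⟩
  simp only [zero_add, smul_eq_mul] at ht
  have := (mul_neg_iff.1 ht)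
  rcases this with h | h
  · linarith [h.2]
  · exact absurd (inv_pos.2 ht0) (not_lt.2 h.1.le)

lemma expSum_le_mul_exp_deriv {ι : Type} [Fintype ι] (A : ι → ℝ) {r ρ : ℝ} (hr : 0 ≤ r)
    (hρ : walkGrowth (hlineCount A) < ρ) (hd : 0 < ∑ k, A k * exp (r * A k)) :
    expSum A r ≤ ρ * exp (r * (2 * (∑ k, A k * exp (r * A k)) / expSum A r)) := by
  have hF : 0 < expSum A r := by
    refine Finset.sum_pos (fun _ _ => exp_pos _) (Finset.nonempty_iff_ne_empty.2 fun h => ?_)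
    simp [h] at hd
  set D := ∑ k, A k * exp (r * A k) with hD
  have h1 : HasDerivAt (fun t => expSum A (r - t)) (-D) 0 := by
    have := (hasDerivAt_expSum A (r - 0)).comp_const_sub r 0
    simpa [hD] using this
  have h2 : HasDerivAt (fun t => expSum A (r + t) * exp (-(t * (2 * D / expSum A r)))) (-D) 0 := by
    have e1 := (hasDerivAt_expSum A (r + 0)).comp_const_add r 0
    have e2 := (((hasDerivAt_id (0 : ℝ)).mul_const (2 * D / expSum A r)).neg).exp
    have e3 := e1.mul e2
    refine e3.congr_deriv ?_
    simp only [add_zero, ← hD, id_eq, one_mul, zero_mul, neg_zero, exp_zero, Pi.neg_apply]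
    field_simp
    ring
  obtain ⟨t, ht, h1'⟩ := exists_pos_lt_of_hasDerivAt_neg h1 (by linarith)
  obtain ⟨t', ht', h2'⟩ := exists_pos_lt_of_hasDerivAt_neg h2 (by linarith)
  exact expSum_le_mul_exp A hr ht.le ht'.le hρ (by simpa using h1') (by simpa using h2')

lemma strictMono_deriv_expSum {ι : Type} [Fintype ι] (A : ι → ℝ) {k₀ : ι} (hk₀ : 0 < A k₀) :
    StrictMono fun r => ∑ k, A k * exp (r * A k) := by
  intro r s hrs
  refine Finset.sum_lt_sum (fun k _ => ?_) ⟨k₀, mem_univ _, ?_⟩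
  · rcases le_total 0 (A k) with h | h
    · exact mul_le_mul_of_nonneg_left (exp_le_exp.2 (by nlinarith)) h
    · exact mul_le_mul_of_nonpos_left (exp_le_exp.2 (by nlinarith)) h
  · exact mul_lt_mul_of_pos_left (exp_lt_exp.2 (by nlinarith)) hk₀

lemma exists_deriv_expSum_nonneg {ι : Type} [Fintype ι] (A : ι → ℝ) {k₀ : ι} (hk₀ : 0 < A k₀) :
    ∃ R ≥ 0, 0 ≤ ∑ k, A k * exp (R * A k) := by
  classical
  set C := ∑ k, |A k| with hC
  have hC0 : 0 ≤ C := Finset.sum_nonneg fun _ _ => abs_nonneg _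
  refine ⟨C / (A k₀ * A k₀), by positivity, ?_⟩
  set R := C / (A k₀ * A k₀) with hR
  have hR0 : 0 ≤ R := by positivity
  have h1 : C ≤ A k₀ * exp (R * A k₀) := by
    have h2 : A k₀ * (R * A k₀) = C := by rw [hR]; field_simp
    have := Real.add_one_le_exp (R * A k₀)
    nlinarith
  have h2 : -C ≤ ∑ k ∈ univ.erase k₀, A k * exp (R * A k) := by
    calc -C ≤ ∑ k ∈ univ.erase k₀, -|A k| := by
          rw [Finset.sum_neg_distrib, neg_le_neg_iff]
          exact Finset.sum_le_sum_of_subset_of_nonneg (Finset.erase_subset _ _)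
            fun _ _ _ => abs_nonneg _
      _ ≤ _ := Finset.sum_le_sum fun k _ => by
          rcases le_total 0 (A k) with h | h
          · nlinarith [abs_nonneg (A k), mul_nonneg h (exp_pos (R * A k)).le]
          · have : exp (R * A k) ≤ 1 := exp_le_one_iff.2 (mul_nonpos_of_nonneg_of_nonpos hR0 h)
            rw [abs_of_nonpos h]
            nlinarith
  rw [← Finset.add_sum_erase _ _ (mem_univ k₀)]
  linarith

lemma exists_expSum_le_of_pos {ι : Type} [Fintype ι] (A : ι → ℝ) {k₀ : ι} (hk₀ : 0 < A k₀)
    {ρ : ℝ} (hρ : walkGrowth (hlineCount A) < ρ) : ∃ r ≥ 0, expSum A r ≤ ρ := by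
  have hcont : Continuous fun r => ∑ k, A k * exp (r * A k) := by fun_prop
  have hcontF : Continuous (expSum A) := by unfold expSum; fun_prop
  rcases lt_or_ge 0 (∑ k, A k * exp (0 * A k)) with h0 | h0
  · exact ⟨0, le_rfl, by simpa using expSum_le_mul_exp_deriv A le_rfl hρ h0⟩
  obtain ⟨R, hR, hR'⟩ := exists_deriv_expSum_nonneg A hk₀
  obtain ⟨r, hr, hr0⟩ := intermediate_value_Icc hR hcont.continuousOn ⟨h0, hR'⟩
  refine ⟨r, hr.1, ?_⟩
  have hF : expSum A r ≠ 0 :=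
    (Finset.sum_pos (fun _ _ => exp_pos _) ⟨k₀, mem_univ _⟩).ne'
  have hlim : Tendsto
      (fun s => ρ * exp (s * (2 * (∑ k, A k * exp (s * A k)) / expSum A s))) (𝓝[>] r)
      (𝓝 (ρ * exp (r * (2 * (∑ k, A k * exp (r * A k)) / expSum A r)))) := by
    refine Tendsto.mono_left (ContinuousAt.tendsto ?_) nhdsWithin_le_nhds
    have := hcontF.continuousAt (x := r)
    have := hcont.continuousAt (x := r)
    fun_prop (disch := assumption)
  have hr0' : ∑ k, A k * exp (r * A k) = 0 := hr0
  rw [hr0', mul_zero, zero_div, mul_zero, exp_zero, mul_one] at hlim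
  refine le_of_tendsto_of_tendsto ((hcontF.tendsto r).mono_left nhdsWithin_le_nhds) hlim ?_
  filter_upwards [self_mem_nhdsWithin] with s hs
  exact expSum_le_mul_exp_deriv A (hr.1.trans (le_of_lt hs)) hρ
    (hr0'.symm.le.trans_lt (strictMono_deriv_expSum A hk₀ hs))

/-- The growth constant of half-line walks is bounded below by the infimum of the exponential
moments over nonnegative parameters, when some positive weighting of the steps is centred. -/
lemma le_walkGrowth_hlineCount {ι : Type} [Fintype ι] (A : ι → ℝ) (p : ι → ℝ)
    (hp : ∀ k, 0 < p k) (hpA : ∑ k, p k * A k = 0) {m : ℝ} (hm : ∀ r ≥ 0, m ≤ expSum A r) :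
    m ≤ walkGrowth (hlineCount A) := by
  by_cases h : ∃ k, 0 < A k
  · obtain ⟨k₀, hk₀⟩ := h
    refine le_of_forall_gt_imp_ge_of_dense fun ρ hρ => ?_
    obtain ⟨r, hr, hle⟩ := exists_expSum_le_of_pos A hk₀ hρ
    exact (hm r hr).trans hle
  · push Not at h
    have hA (k : ι) : A k = 0 := by
      have := (Finset.sum_eq_zero_iff_of_nonpos
        (fun k _ => mul_nonpos_of_nonneg_of_nonpos (hp k).le (h k))).1 hpA k (mem_univ k)
      exact (mul_eq_zero.1 this).resolve_left (hp k).ne'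
    have hcount (n : ℕ) (hn : n ≠ 0) :
        (hlineCount A n : ℝ) ^ ((n : ℝ)⁻¹) = Fintype.card ι := by
      have : hlineCount A n = Fintype.card ι ^ n := by
        classical
        simp [hlineCount, IsHalfLineWalk, hA]
      rw [this, Nat.cast_pow, Real.pow_rpow_inv_natCast (Nat.cast_nonneg _) hn]
    have hlim : Tendsto (fun n : ℕ => (hlineCount A n : ℝ) ^ ((n : ℝ)⁻¹)) atTop
        (𝓝 (Fintype.card ι : ℝ)) := by
      refine tendsto_const_nhds.congr' ?_
      filter_upwards [eventually_ne_atTop 0] with n hn using (hcount n hn).symm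
    rw [walkGrowth, hlim.limsup_eq]
    simpa [expSum] using hm 0 le_rfl

/-- A sum of exponentials is globally minimal at a critical point. -/
lemma sum_exp_le_of_critical {ι : Type} [Fintype ι] (x y : ι → ℝ)
    (h : ∑ k, exp (x k) * (y k - x k) = 0) : ∑ k, exp (x k) ≤ ∑ k, exp (y k) := by
  rw [← add_zero (∑ k, exp (x k)), ← h, ← Finset.sum_add_distrib]
  refine Finset.sum_le_sum fun k _ => ?_
  have h1 := Real.add_one_le_exp (y k - x k)
  have h2 : exp (y k) = exp (x k) * exp (y k - x k) := by rw [← Real.exp_add]; ring_nf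
  rw [h2]
  nlinarith [exp_pos (x k)]

/-- If the critical point `(a, b)` lies strictly to the left of the first quadrant, then values on
the quadrant are bounded below by values on the vertical half-axis. -/
lemma exists_expSum_le_of_critical {ι : Type} [Fintype ι] (u v : ι → ℝ) {a b s t : ℝ}
    (hu : ∑ k, exp (a * u k + b * v k) * u k = 0)
    (hv : ∑ k, exp (a * u k + b * v k) * v k = 0)
    (ha : a < 0) (hb : 0 ≤ b) (hs : 0 ≤ s) (ht : 0 ≤ t) :
    ∃ r ≥ 0, expSum v r ≤ ∑ k, exp (s * u k + t * v k) := by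
  have hsa : 0 < s - a := by linarith
  set l := -a / (s - a) with hl
  have hl0 : 0 ≤ l := div_nonneg (by linarith) hsa.le
  have hl1 : 0 ≤ 1 - l := by
    rw [sub_nonneg, hl, div_le_one hsa]; linarith
  have hcross : (1 - l) * a + l * s = 0 := by
    rw [hl]; field_simp; ring
  refine ⟨(1 - l) * b + l * t, by positivity, ?_⟩
  have hmin : ∑ k, exp (a * u k + b * v k) ≤ ∑ k, exp (s * u k + t * v k) := by
    refine sum_exp_le_of_critical _ _ ?_
    calc _ = ∑ k, ((s - a) * (exp (a * u k + b * v k) * u k) +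
          (t - b) * (exp (a * u k + b * v k) * v k)) :=
          Finset.sum_congr rfl fun k _ => by ring
      _ = 0 := by rw [Finset.sum_add_distrib, ← Finset.mul_sum, ← Finset.mul_sum, hu, hv]; ring
  calc expSum v ((1 - l) * b + l * t)
      ≤ ∑ k, ((1 - l) * exp (a * u k + b * v k) + l * exp (s * u k + t * v k)) := by
        refine Finset.sum_le_sum fun k _ => ?_
        have := convexOn_exp.2 (Set.mem_univ (a * u k + b * v k))
          (Set.mem_univ (s * u k + t * v k)) hl1 hl0 (by ring)
        simp only [smul_eq_mul] at this
        refine le_of_eq_of_le (congrArg exp ?_) this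
        linear_combination -(u k) * hcross
    _ = (1 - l) * ∑ k, exp (a * u k + b * v k) + l * ∑ k, exp (s * u k + t * v k) := by
        rw [Finset.sum_add_distrib, ← Finset.mul_sum, ← Finset.mul_sum]
    _ ≤ ∑ k, exp (s * u k + t * v k) := by nlinarith

lemma zpow_mul_zpow_eq_exp {α β : ℝ} (hα : 0 < α) (hβ : 0 < β) (i j : ℤ) :
    α ^ i * β ^ j = exp (log α * i + log β * j) := by
  rw [Real.exp_add, ← Real.rpow_def_of_pos hα, ← Real.rpow_def_of_pos hβ, Real.rpow_intCast,
    Real.rpow_intCast]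

lemma sum_zpow_mul_eq_zero_of_deriv {ι : Type} [Fintype ι] (e : ι → ℤ) (c : ι → ℝ) {x : ℝ}
    (hx : 0 < x) (h : deriv (fun x => ∑ k, x ^ e k * c k) x = 0) :
    ∑ k, x ^ e k * c k * e k = 0 := by
  have hd : HasDerivAt (fun x => ∑ k, x ^ e k * c k) (∑ k, (e k : ℝ) * x ^ (e k - 1) * c k) x :=
    HasDerivAt.fun_sum fun k _ => (hasDerivAt_zpow (e k) x (Or.inl hx.ne')).mul_const (c k)
  rw [hd.deriv] at h
  rw [← mul_zero x, ← h, Finset.mul_sum]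
  refine Finset.sum_congr rfl fun k _ => ?_
  rw [zpow_sub_one₀ hx.ne']
  field_simp

/-- Let `S ⊂ ℤ²` define a nontrivial quarter-plane model with inventory
`P`, and let `(α,β)` be the unique positive critical point of `P` with `β ≠ 1` and
`log α / log β < 0`. Then the minimum of `K_S(θ)` over `θ ∈ [0, π/2]` is attained at an
endpoint, i.e. it equals `K_S(0)` or `K_S(π/2)`. -/
theorem min_bound_at_endpoint {ι : Type} [Fintype ι] (S : ι → ℤ × ℤ)
    (hnt : NontrivialQP S)
    (α β : ℝ) (hα : 0 < α) (hβ : 0 < β)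
    (hcx : deriv (fun x => Pinv S x β) α = 0)
    (hcy : deriv (fun y => Pinv S α y) β = 0)
    (huniq : ∀ α' β' : ℝ, 0 < α' → 0 < β' →
      deriv (fun x => Pinv S x β') α' = 0 → deriv (fun y => Pinv S α' y) β' = 0 →
      (α', β') = (α, β))
    (hβ1 : β ≠ 1) (hratio : Real.log α / Real.log β < 0) :
    (∀ θ ∈ Set.Icc (0 : ℝ) (Real.pi / 2),
      walkGrowth (walkCount S (Hplane 0)) ≤ walkGrowth (walkCount S (Hplane θ))) ∨
    (∀ θ ∈ Set.Icc (0 : ℝ) (Real.pi / 2),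
      walkGrowth (walkCount S (Hplane (Real.pi / 2))) ≤
        walkGrowth (walkCount S (Hplane θ))) := by
  have hu : ∑ k, exp (log α * ((S k).1 : ℝ) + log β * ((S k).2 : ℝ)) * ((S k).1 : ℝ) = 0 := by
    simpa only [zpow_mul_zpow_eq_exp hα hβ] using
      sum_zpow_mul_eq_zero_of_deriv (fun k => (S k).1) (fun k => β ^ (S k).2) hα hcx
  have hv : ∑ k, exp (log α * ((S k).1 : ℝ) + log β * ((S k).2 : ℝ)) * ((S k).2 : ℝ) = 0 := by
    have hcy' : deriv (fun y => ∑ k, y ^ (S k).2 * α ^ (S k).1) β = 0 := by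
      simpa only [Pinv, mul_comm] using hcy
    have := sum_zpow_mul_eq_zero_of_deriv (fun k => (S k).2) (fun k => α ^ (S k).1) hβ hcy'
    simpa only [zpow_mul_zpow_eq_exp hβ hα, add_comm] using this
  have hu' : ∑ k, exp (log β * ((S k).2 : ℝ) + log α * ((S k).1 : ℝ)) * ((S k).1 : ℝ) = 0 := by
    simpa only [add_comm] using hu
  have hv' : ∑ k, exp (log β * ((S k).2 : ℝ) + log α * ((S k).1 : ℝ)) * ((S k).2 : ℝ) = 0 := by
    simpa only [add_comm] using hv
  have hcentred (θ : ℝ) : ∑ k, exp (log α * ((S k).1 : ℝ) + log β * ((S k).2 : ℝ)) *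
      Atheta S θ k = 0 := by
    calc _ = ∑ k, (exp (log α * ((S k).1 : ℝ) + log β * ((S k).2 : ℝ)) * ((S k).1 : ℝ) * sin θ +
          exp (log α * ((S k).1 : ℝ) + log β * ((S k).2 : ℝ)) * ((S k).2 : ℝ) * cos θ) :=
          Finset.sum_congr rfl fun k _ => by simp only [Atheta]; ring
      _ = 0 := by
          rw [Finset.sum_add_distrib, ← Finset.sum_mul, ← Finset.sum_mul, hu, hv]; ring
  have hsin {θ : ℝ} (h : θ ∈ Set.Icc (0 : ℝ) (π / 2)) : 0 ≤ sin θ :=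
    sin_nonneg_of_nonneg_of_le_pi h.1 (by linarith [h.2, pi_pos])
  have hcos {θ : ℝ} (h : θ ∈ Set.Icc (0 : ℝ) (π / 2)) : 0 ≤ cos θ :=
    cos_nonneg_of_neg_pi_div_two_le_of_le (by linarith [h.1, pi_pos]) h.2
  simp only [walkCount_Hplane]
  rcases div_neg_iff.1 hratio with ⟨ha, hb⟩ | ⟨ha, hb⟩
  · right
    intro θ hθ
    refine le_walkGrowth_hlineCount _ _ (fun k => exp_pos _) (hcentred θ) fun r hr => ?_
    obtain ⟨q, hq, hle⟩ := exists_expSum_le_of_critical (fun k => ((S k).2 : ℝ))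
      (fun k => ((S k).1 : ℝ)) hv' hu' hb ha.le (mul_nonneg hr (hcos hθ))
      (mul_nonneg hr (hsin hθ))
    refine (walkGrowth_hlineCount_le _ hq).trans (le_of_eq_of_le ?_ (hle.trans_eq ?_))
    · simp [expSum, Atheta]
    · exact Finset.sum_congr rfl fun k _ => by simp only [Atheta]; ring_nf
  · left
    intro θ hθ
    refine le_walkGrowth_hlineCount _ _ (fun k => exp_pos _) (hcentred θ) fun r hr => ?_
    obtain ⟨q, hq, hle⟩ := exists_expSum_le_of_critical (fun k => ((S k).1 : ℝ))
      (fun k => ((S k).2 : ℝ)) hu hv ha hb.le (mul_nonneg hr (hsin hθ))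
      (mul_nonneg hr (hcos hθ))
    refine (walkGrowth_hlineCount_le _ hq).trans (le_of_eq_of_le ?_ (hle.trans_eq ?_))
    · simp [expSum, Atheta]
    · exact Finset.sum_congr rfl fun k _ => by simp only [Atheta]; ring_nf
end

section
/- Let S ⊆ ℤ² be finite with inventory P(x,y) = Σ_{(i,j)∈S} x^i y^j, and suppose (α, β) is the unique critical point of P in (0,∞)². Set θ* = arctan(log α / log β) if β ≠ 1, and θ* = π/2 if β = 1. Let χ_{θ*}(u) = Σ_{(i,j)∈S} u^{i sin θ* + j cos θ*} and let τ_{θ*} be its unique positive critical point. Then P(α, β) = χ_{θ*}(τ_{θ*}). -/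
open scoped BigOperators

theorem hasDerivAt_Pinv_fst {ι : Type} [Fintype ι] (S : ι → ℤ × ℤ) {x : ℝ} (hx : 0 < x)
    (y : ℝ) :
    HasDerivAt (fun x => Pinv S x y) ((∑ k, ((S k).1 : ℝ) * (x ^ (S k).1 * y ^ (S k).2)) / x) x := by
  rw [Finset.sum_div]
  unfold Pinv
  refine HasDerivAt.fun_sum fun k _ => ?_
  refine ((hasDerivAt_zpow (S k).1 x (Or.inl hx.ne')).mul_const (y ^ (S k).2)).congr_deriv ?_
  rw [zpow_sub_one₀ hx.ne']
  ring

theorem hasDerivAt_Pinv_snd {ι : Type} [Fintype ι] (S : ι → ℤ × ℤ) (x : ℝ) {y : ℝ}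
    (hy : 0 < y) :
    HasDerivAt (fun y => Pinv S x y) ((∑ k, ((S k).2 : ℝ) * (x ^ (S k).1 * y ^ (S k).2)) / y) y := by
  rw [Finset.sum_div]
  unfold Pinv
  refine HasDerivAt.fun_sum fun k _ => ?_
  refine ((hasDerivAt_zpow (S k).2 y (Or.inl hy.ne')).const_mul (x ^ (S k).1)).congr_deriv ?_
  rw [zpow_sub_one₀ hy.ne']
  ring

theorem hasDerivAt_chi {ι : Type} [Fintype ι] (A : ι → ℝ) {u : ℝ} (hu : 0 < u) :
    HasDerivAt (chi A) ((∑ k, A k * u ^ A k) / u) u := by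
  rw [Finset.sum_div]
  unfold chi
  refine HasDerivAt.fun_sum fun k _ => ?_
  refine HasDerivAt.congr_deriv (Real.hasDerivAt_rpow_const (p := A k) (Or.inl hu.ne')) ?_
  rw [Real.rpow_sub_one hu.ne', mul_div_assoc]

theorem rpow_Atheta {ι : Type} (S : ι → ℤ × ℤ) (θ : ℝ) {u : ℝ} (hu : 0 < u) (k : ι) :
    u ^ Atheta S θ k = (u ^ Real.sin θ) ^ (S k).1 * (u ^ Real.cos θ) ^ (S k).2 := by
  rw [Atheta, Real.rpow_add hu, mul_comm _ (Real.sin θ), mul_comm _ (Real.cos θ),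
    Real.rpow_mul hu.le, Real.rpow_mul hu.le, Real.rpow_intCast, Real.rpow_intCast]

/-- If `(α, β) = (u ^ sin θ, u ^ cos θ)` is a critical point of the inventory, then `u` is a
critical point of its projection in direction `θ`. -/
theorem deriv_chi_Atheta_eq_zero {ι : Type} [Fintype ι] (S : ι → ℤ × ℤ) {α β θ u : ℝ}
    (hα : 0 < α) (hβ : 0 < β) (hu : 0 < u)
    (hcx : deriv (fun x => Pinv S x β) α = 0) (hcy : deriv (fun y => Pinv S α y) β = 0)
    (hsin : u ^ Real.sin θ = α) (hcos : u ^ Real.cos θ = β) :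
    deriv (chi (Atheta S θ)) u = 0 := by
  rw [(hasDerivAt_Pinv_fst S hα β).deriv, div_eq_zero_iff, or_iff_left hα.ne'] at hcx
  rw [(hasDerivAt_Pinv_snd S α hβ).deriv, div_eq_zero_iff, or_iff_left hβ.ne'] at hcy
  rw [(hasDerivAt_chi _ hu).deriv, div_eq_zero_iff]
  left
  calc ∑ k, Atheta S θ k * u ^ Atheta S θ k
      = Real.sin θ * ∑ k, ((S k).1 : ℝ) * (α ^ (S k).1 * β ^ (S k).2) +
        Real.cos θ * ∑ k, ((S k).2 : ℝ) * (α ^ (S k).1 * β ^ (S k).2) := by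
        rw [Finset.mul_sum, Finset.mul_sum, ← Finset.sum_add_distrib]
        refine Finset.sum_congr rfl fun k _ => ?_
        rw [rpow_Atheta S θ hu, hsin, hcos, Atheta]
        ring
    _ = 0 := by rw [hcx, hcy, mul_zero, mul_zero, add_zero]

/-- The direction `θ` attached to `(α, β)` is the one along which `(log α, log β)` points. -/
theorem exists_rpow_sin_cos {α β θ : ℝ} (hα : 0 < α) (hβ : 0 < β)
    (hθ : θ = if β = 1 then Real.pi / 2 else Real.arctan (Real.log α / Real.log β)) :
    ∃ u : ℝ, 0 < u ∧ u ^ Real.sin θ = α ∧ u ^ Real.cos θ = β := by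
  split_ifs at hθ with h
  · exact ⟨α, hα, by simp [hθ], by simp [hθ, h]⟩
  · have hlog : Real.log β ≠ 0 := Real.log_ne_zero_of_pos_of_ne_one hβ h
    have hc : Real.cos θ ≠ 0 := hθ ▸ (Real.cos_arctan_pos _).ne'
    have ht : Real.sin θ / Real.cos θ = Real.log α / Real.log β := by
      rw [← Real.tan_eq_sin_div_cos, hθ, Real.tan_arctan]
    refine ⟨Real.exp (Real.log β / Real.cos θ), Real.exp_pos _, ?_, ?_⟩
    · rw [← Real.exp_mul, div_mul_eq_mul_div, mul_div_assoc, ht, mul_div_cancel₀ _ hlog,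
        Real.exp_log hα]
    · rw [← Real.exp_mul, div_mul_cancel₀ _ hc, Real.exp_log hβ]

/-- Let `S ⊆ ℤ²` be finite with inventory `P` whose unique critical
point in `(0,∞)²` is `(α,β)`. Set `θ* = arctan(log α / log β)` if `β ≠ 1` and
`θ* = π/2` if `β = 1`. If `τ` is the unique positive critical point of
`χ_{θ*}(u) = ∑_{(i,j)∈S} u^{i sin θ* + j cos θ*}`, then `P(α,β) = χ_{θ*}(τ)`. -/
theorem crit_value_eq_chi_crit_value {ι : Type} [Fintype ι] (S : ι → ℤ × ℤ)
    (α β : ℝ) (hα : 0 < α) (hβ : 0 < β)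
    (hcx : deriv (fun x => Pinv S x β) α = 0)
    (hcy : deriv (fun y => Pinv S α y) β = 0)
    (huniq : ∀ α' β' : ℝ, 0 < α' → 0 < β' →
      deriv (fun x => Pinv S x β') α' = 0 → deriv (fun y => Pinv S α' y) β' = 0 →
      (α', β') = (α, β))
    (θstar : ℝ)
    (hθ : θstar = if β = 1 then Real.pi / 2 else Real.arctan (Real.log α / Real.log β))
    (τ : ℝ) (hτpos : 0 < τ) (hτcrit : deriv (chi (Atheta S θstar)) τ = 0)
    (hτuniq : ∀ u : ℝ, 0 < u → deriv (chi (Atheta S θstar)) u = 0 → u = τ) :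
    Pinv S α β = chi (Atheta S θstar) τ := by
  obtain ⟨u, hu, hsin, hcos⟩ := exists_rpow_sin_cos hα hβ hθ
  rw [← hτuniq u hu (deriv_chi_Atheta_eq_zero S hα hβ hu hcx hcy hsin hcos)]
  exact Finset.sum_congr rfl fun k _ => by rw [rpow_Atheta S θstar hu, hsin, hcos]
end

section
/- Let S ⊆ {−1, 0, 1}² \ {(0,0)} be a finite set of small steps defining a nontrivial quarter-plane lattice path model. Then the growth constant of the quarter-plane counting sequence equals the minimum over bounding half-plane growth constants: K_S = min_{θ ∈ [0, π/2]} K_S(θ). -/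
open scoped BigOperators

/-- The transfer operator of the steps `S` restricted to the region `R`. -/
noncomputable def transfer {ι : Type} [Fintype ι] (S : ι → ℤ × ℤ) (R : Set (ℝ × ℝ))
    (f : ℝ × ℝ → ℝ) (z : ℝ × ℝ) : ℝ :=
  open Classical in
  ∑ s, if z + (((S s).1 : ℝ), ((S s).2 : ℝ)) ∈ R
    then f (z + (((S s).1 : ℝ), ((S s).2 : ℝ))) else 0

section Transfer

variable {ι : Type} [Fintype ι] {S : ι → ℤ × ℤ} {R : Set (ℝ × ℝ)}

lemma transfer_univ (f : ℝ × ℝ → ℝ) (z : ℝ × ℝ) :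
    transfer S Set.univ f z = ∑ s, f (z + (((S s).1 : ℝ), ((S s).2 : ℝ))) := by
  simp [transfer]

open Classical in
lemma card_walks_from (S : ι → ℤ × ℤ) (R : Set (ℝ × ℝ)) (n : ℕ) (z : ℝ × ℝ) :
    (∑ w : Fin n → ι, if ∀ m : Fin n, z +
      ((∑ i : Fin n, if i ≤ m then ((S (w i)).1 : ℝ) else 0),
       (∑ i : Fin n, if i ≤ m then ((S (w i)).2 : ℝ) else 0)) ∈ R then (1 : ℝ) else 0) =
      (transfer S R)^[n] (fun _ => 1) z := by
  induction n generalizing z with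
  | zero => simp
  | succ n ih =>
    rw [Function.iterate_succ_apply', transfer,
      ← Equiv.sum_comp (Fin.consEquiv (fun _ : Fin (n + 1) => ι)), Fintype.sum_prod_type]
    refine Finset.sum_congr rfl fun s _ => ?_
    rw [← ih]
    by_cases h : z + (((S s).1 : ℝ), ((S s).2 : ℝ)) ∈ R
    · rw [if_pos h]
      refine Finset.sum_congr rfl fun w _ => ?_
      refine if_congr ?_ rfl rfl
      simp only [Fin.consEquiv_apply, Fin.forall_fin_succ, Fin.sum_univ_succ, Fin.cons_zero,
        Fin.cons_succ, Fin.succ_le_succ_iff, Fin.zero_le, if_true]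
      simp only [Fin.le_zero_iff, Fin.succ_ne_zero, if_false, Finset.sum_const_zero, add_zero, h,
        true_and]
      simp only [add_assoc, Prod.mk_add_mk]
    · rw [if_neg h]
      refine Finset.sum_eq_zero fun w _ => if_neg fun hw => h ?_
      have := hw 0
      simpa [Fin.sum_univ_succ, Fin.le_zero_iff, Fin.succ_ne_zero] using this

lemma walkCount_eq_transfer (S : ι → ℤ × ℤ) (R : Set (ℝ × ℝ)) (n : ℕ) :
    (walkCount S R n : ℝ) = (transfer S R)^[n] (fun _ => 1) 0 := by
  classical
  rw [← card_walks_from, walkCount, Finset.sum_boole]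
  refine congrArg _ (Nat.subtype_card _ fun w => ?_)
  rw [Finset.mem_filter]
  simp only [IsWalkIn, zero_add, Finset.mem_univ, true_and]

lemma transfer_mono {f g : ℝ × ℝ → ℝ} (h : ∀ z ∈ R, f z ≤ g z) (z : ℝ × ℝ) :
    transfer S R f z ≤ transfer S R g z := by
  refine Finset.sum_le_sum fun s _ => ?_
  split_ifs with hs
  · exact h _ hs
  · exact le_rfl

lemma transfer_iterate_mono {f g : ℝ × ℝ → ℝ} (h : ∀ z ∈ R, f z ≤ g z) (n : ℕ) :
    ∀ z ∈ R, (transfer S R)^[n] f z ≤ (transfer S R)^[n] g z := by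
  induction n with
  | zero => exact h
  | succ n ih =>
    intro z _
    rw [Function.iterate_succ_apply', Function.iterate_succ_apply']
    exact transfer_mono ih z

lemma transfer_iterate_nonneg {f : ℝ × ℝ → ℝ} (h : ∀ z, 0 ≤ f z) (n : ℕ) (z : ℝ × ℝ) :
    0 ≤ (transfer S R)^[n] f z := by
  induction n generalizing z with
  | zero => exact h z
  | succ n ih =>
    rw [Function.iterate_succ_apply']
    refine Finset.sum_nonneg fun s _ => ?_
    split_ifs
    · exact ih _
    · exact le_rfl

lemma transfer_iterate_le_univ {f : ℝ × ℝ → ℝ} (h : ∀ z, 0 ≤ f z) (n : ℕ) (z : ℝ × ℝ) :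
    (transfer S R)^[n] f z ≤ (transfer S Set.univ)^[n] f z := by
  induction n generalizing z with
  | zero => exact le_rfl
  | succ n ih =>
    rw [Function.iterate_succ_apply', Function.iterate_succ_apply', transfer_univ]
    refine Finset.sum_le_sum fun s _ => ?_
    split_ifs
    · exact ih _
    · exact transfer_iterate_nonneg h n _

lemma transfer_iterate_translate {f g : ℝ × ℝ → ℝ} {d : ℝ × ℝ} (h : ∀ z, f z ≤ g (z + d))
    (n : ℕ) (z : ℝ × ℝ) :
    (transfer S Set.univ)^[n] f z ≤ (transfer S Set.univ)^[n] g (z + d) := by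
  induction n generalizing z with
  | zero => exact h z
  | succ n ih =>
    rw [Function.iterate_succ_apply', Function.iterate_succ_apply', transfer_univ, transfer_univ]
    refine Finset.sum_le_sum fun s _ => ?_
    rw [add_right_comm]
    exact ih _

lemma transfer_iterate_const_mul (f : ℝ × ℝ → ℝ) (C : ℝ) (n : ℕ) (z : ℝ × ℝ) :
    (transfer S R)^[n] (fun z => C * f z) z = C * (transfer S R)^[n] f z := by
  induction n generalizing z with
  | zero => rfl
  | succ n ih =>
    rw [Function.iterate_succ_apply', Function.iterate_succ_apply', transfer, transfer,
      Finset.mul_sum]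
    refine Finset.sum_congr rfl fun s _ => ?_
    rw [ih, mul_ite, mul_zero]

/-- The inventory `∑ exp (a i + b j)` of a planar step set. -/
noncomputable def inventory (S : ι → ℤ × ℤ) (a b : ℝ) : ℝ :=
  ∑ s, Real.exp (a * (S s).1 + b * (S s).2)

lemma transfer_iterate_exp_le (a b : ℝ) (n : ℕ) (z : ℝ × ℝ) :
    (transfer S R)^[n] (fun z => Real.exp (a * z.1 + b * z.2)) z ≤
      Real.exp (a * z.1 + b * z.2) * inventory S a b ^ n := by
  induction n generalizing z with
  | zero => simp
  | succ n ih =>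
    have hpos : 0 ≤ inventory S a b := Finset.sum_nonneg fun s _ => (Real.exp_pos _).le
    rw [Function.iterate_succ_apply', pow_succ', ← mul_assoc, inventory, Finset.mul_sum,
      Finset.sum_mul]
    refine Finset.sum_le_sum fun s _ => ?_
    rw [← inventory]
    split_ifs
    · refine (ih _).trans_eq ?_
      rw [← Real.exp_add, Prod.fst_add, Prod.snd_add]
      congr 2
      ring
    · positivity

lemma walkCount_Hplane_le {θ r : ℝ} (hr : 0 ≤ r) (n : ℕ) :
    (walkCount S (Hplane θ) n : ℝ) ≤ inventory S (r * Real.sin θ) (r * Real.cos θ) ^ n := by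
  rw [walkCount_eq_transfer]
  have h0 : (0 : ℝ × ℝ) ∈ Hplane θ := by simp [Hplane]
  refine (transfer_iterate_mono (g := fun z =>
    Real.exp (r * Real.sin θ * z.1 + r * Real.cos θ * z.2)) (fun z hz => ?_) n 0 h0).trans ?_
  · have hz' : 0 ≤ z.1 * Real.sin θ + z.2 * Real.cos θ := hz
    refine Real.one_le_exp ?_
    nlinarith [mul_nonneg hr hz']
  · simpa using transfer_iterate_exp_le (S := S) (R := Hplane θ) (r * Real.sin θ)
      (r * Real.cos θ) n 0

end Transfer

section Growth

lemma rpow_inv_natCast_le {x C : ℝ} {n : ℕ} (hx : 0 ≤ x) (hC : 0 ≤ C) (hn : n ≠ 0)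
    (h : x ≤ C ^ n) : x ^ ((n : ℝ)⁻¹) ≤ C := by
  calc x ^ ((n : ℝ)⁻¹) ≤ (C ^ n) ^ ((n : ℝ)⁻¹) := Real.rpow_le_rpow hx h (by positivity)
    _ = C := Real.pow_rpow_inv_natCast hC hn

lemma isCoboundedUnder_root (h : ℕ → ℕ) : Filter.IsCoboundedUnder (· ≤ ·) Filter.atTop
    (fun n => (h n : ℝ) ^ ((n : ℝ)⁻¹)) :=
  Filter.isCoboundedUnder_le_of_le (x := 0) Filter.atTop fun n => by positivity

lemma isBoundedUnder_root {h : ℕ → ℕ} {C : ℝ} (hC : 0 ≤ C) (hh : ∀ n, (h n : ℝ) ≤ C ^ n) :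
    Filter.IsBoundedUnder (· ≤ ·) Filter.atTop (fun n => (h n : ℝ) ^ ((n : ℝ)⁻¹)) := by
  refine Filter.isBoundedUnder_of_eventually_le (a := C) ?_
  filter_upwards [Filter.eventually_ne_atTop 0] with n hn
  exact rpow_inv_natCast_le (by positivity) hC hn (hh n)

lemma walkGrowth_le {h : ℕ → ℕ} {C : ℝ} (hC : 0 ≤ C) (hh : ∀ n, (h n : ℝ) ≤ C ^ n) :
    walkGrowth h ≤ C := by
  refine Filter.limsup_le_of_le (isCoboundedUnder_root h) ?_
  filter_upwards [Filter.eventually_ne_atTop 0] with n hn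
  exact rpow_inv_natCast_le (by positivity) hC hn (hh n)

lemma walkGrowth_mono {h h' : ℕ → ℕ} {C : ℝ} (hC : 0 ≤ C) (hle : ∀ n, h n ≤ h' n)
    (hh : ∀ n, (h' n : ℝ) ≤ C ^ n) : walkGrowth h ≤ walkGrowth h' := by
  refine Filter.limsup_le_limsup (Filter.Eventually.of_forall fun n => ?_)
    (isCoboundedUnder_root h) (isBoundedUnder_root hC hh)
  have : (h n : ℝ) ≤ h' n := by exact_mod_cast hle n
  exact Real.rpow_le_rpow (by positivity) this (by positivity)

lemma le_walkGrowth_of_tendsto {h : ℕ → ℕ} {C l : ℝ} (hC : 0 ≤ C) (hh : ∀ n, (h n : ℝ) ≤ C ^ n)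
    {φ : ℕ → ℕ} {u : ℕ → ℝ} (hφ : Filter.Tendsto φ Filter.atTop Filter.atTop)
    (hu : Filter.Tendsto u Filter.atTop (nhds l))
    (hle : ∀ᶠ N in Filter.atTop, u N ≤ (h (φ N) : ℝ) ^ ((φ N : ℝ)⁻¹)) : l ≤ walkGrowth h := by
  refine le_of_forall_lt fun M hM => ?_
  obtain ⟨M', hMM', hM'⟩ := exists_between hM
  refine hMM'.trans_le (Filter.le_limsup_of_frequently_le (a := M') ?_ (isBoundedUnder_root hC hh))
  refine hφ.frequently (Filter.Eventually.frequently ?_)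
  filter_upwards [hle, hu.eventually (lt_mem_nhds hM')] with N h1 h2
  exact h2.le.trans h1

variable {ι : Type} [Fintype ι]

lemma walkCount_mono (S : ι → ℤ × ℤ) {R R' : Set (ℝ × ℝ)} (h : R ⊆ R') (n : ℕ) :
    walkCount S R n ≤ walkCount S R' n :=
  Nat.card_le_card_of_injective
    (fun w : {w : Fin n → ι // IsWalkIn S R w} => (⟨w.1, fun m => h (w.2 m)⟩ :
      {w : Fin n → ι // IsWalkIn S R' w}))
    fun _ _ h => Subtype.ext (congrArg (fun w => w.1) h)

lemma walkCount_le_card_pow (S : ι → ℤ × ℤ) (R : Set (ℝ × ℝ)) (n : ℕ) :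
    (walkCount S R n : ℝ) ≤ (Fintype.card ι : ℝ) ^ n := by
  have : walkCount S R n ≤ Nat.card (Fin n → ι) :=
    Nat.card_le_card_of_injective _ Subtype.val_injective
  rw [Nat.card_eq_fintype_card, Fintype.card_fun, Fintype.card_fin] at this
  exact_mod_cast this

lemma walkGrowth_Quadrant_le (S : ι → ℤ × ℤ) {θ : ℝ} (hθ : θ ∈ Set.Icc 0 (Real.pi / 2)) :
    walkGrowth (walkCount S Quadrant) ≤ walkGrowth (walkCount S (Hplane θ)) := by
  refine walkGrowth_mono (Nat.cast_nonneg _) (walkCount_mono S fun z hz => ?_)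
    (walkCount_le_card_pow S _)
  have h1 : 0 ≤ Real.sin θ := Real.sin_nonneg_of_nonneg_of_le_pi hθ.1
    (by linarith [hθ.2, Real.pi_pos])
  have h2 : 0 ≤ Real.cos θ := Real.cos_nonneg_of_mem_Icc ⟨by linarith [hθ.1, Real.pi_pos], hθ.2⟩
  exact add_nonneg (mul_nonneg hz.1 h1) (mul_nonneg hz.2 h2)

lemma walkGrowth_Hplane_le_inventory (S : ι → ℤ × ℤ) {θ r : ℝ} (hr : 0 ≤ r) :
    walkGrowth (walkCount S (Hplane θ)) ≤ inventory S (r * Real.sin θ) (r * Real.cos θ) :=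
  walkGrowth_le (Finset.sum_nonneg fun _ _ => (Real.exp_pos _).le) (walkCount_Hplane_le hr)

end Growth

section Quadrant

variable {ι : Type} [Fintype ι] {S : ι → ℤ × ℤ}

lemma add_diag_mem_Quadrant {z : ℝ × ℝ} (hz : z ∈ Quadrant) {t : ℝ} (ht : 0 ≤ t) :
    z + (t, t) ∈ Quadrant :=
  ⟨add_nonneg hz.1 ht, add_nonneg hz.2 ht⟩

/-- Some fixed word of length `c` stays in the quadrant and has displacement `(1, 1)`. -/
def HasDiagonalWord (S : ι → ℤ × ℤ) (c : ℕ) : Prop :=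
  ∀ f : ℝ × ℝ → ℝ, (∀ z, 0 ≤ f z) → ∀ z ∈ Quadrant,
    f (z + (1, 1)) ≤ (transfer S Quadrant)^[c] f z

lemma HasDiagonalWord.iterate {c : ℕ} (hc : HasDiagonalWord S c) (J : ℕ) {f : ℝ × ℝ → ℝ}
    (hf : ∀ z, 0 ≤ f z) {z : ℝ × ℝ} (hz : z ∈ Quadrant) :
    f (z + ((J : ℝ), (J : ℝ))) ≤ (transfer S Quadrant)^[c * J] f z := by
  induction J generalizing f with
  | zero =>
    have : z + (((0 : ℕ) : ℝ), ((0 : ℕ) : ℝ)) = z := by simp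
    rw [this]; rfl
  | succ J ih =>
    rw [mul_add_one, Function.iterate_add_apply]
    refine le_trans ?_ (ih (transfer_iterate_nonneg hf c))
    refine le_trans (le_of_eq ?_) (hc f hf _ (add_diag_mem_Quadrant hz J.cast_nonneg))
    have : (((J + 1 : ℕ) : ℝ), ((J + 1 : ℕ) : ℝ)) = ((J : ℝ), (J : ℝ)) + (1, 1) := by
      rw [Prod.mk_add_mk, Nat.cast_add_one]
    rw [this, add_assoc]

lemma transfer_iterate_Quadrant_eq_univ (hS : ∀ s, -1 ≤ (S s).1 ∧ -1 ≤ (S s).2)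
    (f : ℝ × ℝ → ℝ) (n : ℕ) (z : ℝ × ℝ) (h1 : (n : ℝ) ≤ z.1) (h2 : (n : ℝ) ≤ z.2) :
    (transfer S Quadrant)^[n] f z = (transfer S Set.univ)^[n] f z := by
  induction n generalizing z with
  | zero => rfl
  | succ n ih =>
    rw [Function.iterate_succ_apply', Function.iterate_succ_apply', transfer_univ, transfer]
    refine Finset.sum_congr rfl fun s _ => ?_
    have h3 : (-1 : ℝ) ≤ (S s).1 := by exact_mod_cast (hS s).1
    have h4 : (-1 : ℝ) ≤ (S s).2 := by exact_mod_cast (hS s).2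
    push_cast at h1 h2
    have h5 : (n : ℝ) ≤ (z + (((S s).1 : ℝ), ((S s).2 : ℝ))).1 := by
      rw [Prod.fst_add]; linarith
    have h6 : (n : ℝ) ≤ (z + (((S s).1 : ℝ), ((S s).2 : ℝ))).2 := by
      rw [Prod.snd_add]; linarith
    rw [if_pos ⟨n.cast_nonneg.trans h5, n.cast_nonneg.trans h6⟩, ih _ h5 h6]

/-- The number of unconstrained words of length `K` with displacement in the quadrant. -/
noncomputable def endCount (S : ι → ℤ × ℤ) (K : ℕ) : ℝ :=
  (transfer S Set.univ)^[K] (Quadrant.indicator fun _ => 1) 0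

lemma endCount_pow_le (hS : ∀ s, -1 ≤ (S s).1 ∧ -1 ≤ (S s).2) (K r : ℕ) (z : ℝ × ℝ)
    (h1 : (K : ℝ) ≤ z.1) (h2 : (K : ℝ) ≤ z.2) :
    endCount S K ^ r ≤ (transfer S Quadrant)^[K * r] (fun _ => 1) z := by
  induction r generalizing z with
  | zero => simp
  | succ r ih =>
    rw [mul_add_one, add_comm (K * r) K, Function.iterate_add_apply,
      transfer_iterate_Quadrant_eq_univ hS _ K z h1 h2, pow_succ, endCount,
      ← transfer_iterate_const_mul]
    refine (transfer_iterate_translate (d := z) (fun w => ?_) K 0).trans_eq (by rw [zero_add])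
    by_cases hw : w ∈ Quadrant
    · rw [Set.indicator_of_mem hw, mul_one]
      exact ih _ (by rw [Prod.fst_add]; linarith [hw.1]) (by rw [Prod.snd_add]; linarith [hw.2])
    · rw [Set.indicator_of_notMem hw, mul_zero]
      exact transfer_iterate_nonneg (fun _ => zero_le_one) _ _

lemma endCount_pow_le_walkCount (hS : ∀ s, -1 ≤ (S s).1 ∧ -1 ≤ (S s).2) {c : ℕ}
    (hc : HasDiagonalWord S c) (K r : ℕ) :
    endCount S K ^ r ≤ walkCount S Quadrant (c * K + K * r) := by
  rw [walkCount_eq_transfer, Function.iterate_add_apply]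
  refine le_trans ?_ (hc.iterate K (transfer_iterate_nonneg (fun _ => zero_le_one) (K * r))
    (z := 0) ⟨le_rfl, le_rfl⟩)
  exact endCount_pow_le hS K r _ (by simp) (by simp)

lemma le_endCount {c : ℕ} (hc : HasDiagonalWord S c) (k J : ℕ) :
    (transfer S Set.univ)^[k] (Quadrant.indicator fun _ => 1) ((J : ℝ), (J : ℝ)) ≤
      endCount S (c * J + k) := by
  have hnn : ∀ z, 0 ≤ (transfer S Set.univ)^[k] (Quadrant.indicator fun _ => 1) z :=
    transfer_iterate_nonneg (fun _ => Set.indicator_nonneg (fun _ _ => zero_le_one) _) k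
  rw [endCount, Function.iterate_add_apply]
  refine le_trans ?_ (transfer_iterate_le_univ (R := Quadrant) hnn (c * J) 0)
  simpa using hc.iterate J hnn (z := 0) ⟨le_rfl, le_rfl⟩

lemma sum_mul_add_sq_le {W : ι → ℝ} (hW : ∀ s, 0 ≤ W s) {i : ι → ℝ} (hi : ∀ s, i s ^ 2 ≤ 1)
    {m μ : ℝ} (hm : ∑ s, W s = m) (hμ : ∑ s, W s * i s = m * μ) (u : ℝ) :
    ∑ s, W s * (u + i s) ^ 2 ≤ m * ((u + μ) ^ 2 + 1) := by
  have h0 : 0 ≤ m := hm ▸ Finset.sum_nonneg fun s _ => hW s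
  have h1 : ∑ s, W s * (u + i s) ^ 2 =
      (∑ s, W s) * u ^ 2 + 2 * u * (∑ s, W s * i s) + ∑ s, W s * i s ^ 2 := by
    rw [Finset.sum_mul, Finset.mul_sum, ← Finset.sum_add_distrib, ← Finset.sum_add_distrib]
    exact Finset.sum_congr rfl fun s _ => by ring
  have h2 : ∑ s, W s * i s ^ 2 ≤ m :=
    hm ▸ Finset.sum_le_sum fun s _ => mul_le_of_le_one_right (hW s) (hi s)
  rw [h1, hm, hμ]
  nlinarith [mul_nonneg h0 (sq_nonneg μ)]

/-- A tilted Chebyshev lower bound, propagated by the transfer operator. -/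
lemma exp_mul_le_transfer_iterate (hS : ∀ s, |(S s).1| ≤ 1 ∧ |(S s).2| ≤ 1) {a b μ ν : ℝ}
    (hμ : ∑ s, Real.exp (a * (S s).1 + b * (S s).2) * (S s).1 = inventory S a b * μ)
    (hν : ∑ s, Real.exp (a * (S s).1 + b * (S s).2) * (S s).2 = inventory S a b * ν)
    {f : ℝ × ℝ → ℝ} {C J X Y : ℝ} (hC : 0 ≤ C)
    (hf : ∀ z, C * Real.exp (a * z.1 + b * z.2) *
      (1 - ((z.1 - X) ^ 2 + (z.2 - Y) ^ 2) / J ^ 2) ≤ f z) (k : ℕ) (z : ℝ × ℝ) :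
    C * inventory S a b ^ k * Real.exp (a * z.1 + b * z.2) *
      (1 - ((z.1 + k * μ - X) ^ 2 + (z.2 + k * ν - Y) ^ 2 + 2 * k) / J ^ 2) ≤
      (transfer S Set.univ)^[k] f z := by
  induction k generalizing z with
  | zero => simpa using hf z
  | succ k ih =>
    rw [Function.iterate_succ_apply', transfer_univ]
    refine le_trans ?_ (Finset.sum_le_sum fun s _ => ih _)
    set m := inventory S a b with hm
    set W : ι → ℝ := fun s => Real.exp (a * (S s).1 + b * (S s).2) with hWdef
    have hW : ∀ s, 0 ≤ W s := fun s => (Real.exp_pos _).le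
    have hWm : ∑ s, W s = m := rfl
    have hm0 : 0 ≤ m := Finset.sum_nonneg fun s _ => hW s
    have hsq1 : ∀ s, ((S s).1 : ℝ) ^ 2 ≤ 1 := fun s => by
      rw [sq_le_one_iff_abs_le_one]; exact_mod_cast (hS s).1
    have hsq2 : ∀ s, ((S s).2 : ℝ) ^ 2 ≤ 1 := fun s => by
      rw [sq_le_one_iff_abs_le_one]; exact_mod_cast (hS s).2
    have e1 := sum_mul_add_sq_le hW hsq1 hWm hμ (z.1 + k * μ - X)
    have e2 := sum_mul_add_sq_le hW hsq2 hWm hν (z.2 + k * ν - Y)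
    have key : ∀ s, C * m ^ k * Real.exp (a * (z + (((S s).1 : ℝ), ((S s).2 : ℝ))).1 +
          b * (z + (((S s).1 : ℝ), ((S s).2 : ℝ))).2) *
        (1 - (((z + (((S s).1 : ℝ), ((S s).2 : ℝ))).1 + k * μ - X) ^ 2 +
          ((z + (((S s).1 : ℝ), ((S s).2 : ℝ))).2 + k * ν - Y) ^ 2 + 2 * k) / J ^ 2) =
        C * m ^ k * Real.exp (a * z.1 + b * z.2) * (W s - (W s * (z.1 + k * μ - X + (S s).1) ^ 2 +
          W s * (z.2 + k * ν - Y + (S s).2) ^ 2 + W s * (2 * k)) / J ^ 2) := by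
      intro s
      have : Real.exp (a * (z + (((S s).1 : ℝ), ((S s).2 : ℝ))).1 +
          b * (z + (((S s).1 : ℝ), ((S s).2 : ℝ))).2) = Real.exp (a * z.1 + b * z.2) * W s := by
        rw [hWdef, ← Real.exp_add, Prod.fst_add, Prod.snd_add]
        congr 1
        ring
      rw [this, Prod.fst_add, Prod.snd_add]
      ring
    simp_rw [key]
    rw [← Finset.mul_sum, Finset.sum_sub_distrib, ← Finset.sum_div, Finset.sum_add_distrib,
      Finset.sum_add_distrib, ← Finset.sum_mul, hWm, pow_succ, ← mul_assoc,
      mul_right_comm _ m, mul_assoc _ m]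
    refine mul_le_mul_of_nonneg_left ?_ (by positivity)
    rw [mul_sub, mul_one, ← mul_div_assoc]
    refine sub_le_sub_left (div_le_div_of_nonneg_right ?_ (sq_nonneg J)) _
    push_cast
    have r1 : z.1 + (k + 1) * μ - X = z.1 + k * μ - X + μ := by ring
    have r2 : z.2 + (k + 1) * ν - Y = z.2 + k * ν - Y + ν := by ring
    rw [r1, r2]
    linarith

lemma inventory_pow_le_transfer_iterate (hS : ∀ s, |(S s).1| ≤ 1 ∧ |(S s).2| ≤ 1)
    {a b μ ν : ℝ} (ha : 0 ≤ a) (hb : 0 ≤ b) (hμ0 : 0 ≤ μ) (hν0 : 0 ≤ ν)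
    (haμ : a * μ = 0) (hbν : b * ν = 0)
    (hμ : ∑ s, Real.exp (a * (S s).1 + b * (S s).2) * (S s).1 = inventory S a b * μ)
    (hν : ∑ s, Real.exp (a * (S s).1 + b * (S s).2) * (S s).2 = inventory S a b * ν)
    {k J : ℕ} (hJ : 0 < J) (hkJ : 4 * k ≤ J ^ 2) :
    inventory S a b ^ k * Real.exp (-(J * (a + b + 1))) ≤
      (transfer S Set.univ)^[k] (Quadrant.indicator fun _ => 1) ((J : ℝ), (J : ℝ)) := by
  have hJ0 : (0 : ℝ) < J := by exact_mod_cast hJ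
  have hm0 : 0 ≤ inventory S a b := Finset.sum_nonneg fun s _ => (Real.exp_pos _).le
  have hkJ' : 4 * (k : ℝ) ≤ (J : ℝ) ^ 2 := by exact_mod_cast hkJ
  have main := exp_mul_le_transfer_iterate hS hμ hν (f := Quadrant.indicator fun _ => 1)
    (C := Real.exp (-(2 * J * (a + b)))) (J := J) (X := J + k * μ) (Y := J + k * ν)
    (Real.exp_pos _).le ?_ k ((J : ℝ), (J : ℝ))
  · refine le_trans ?_ main
    have h1 : (1 : ℝ) / 2 ≤ 1 - (((J : ℝ) + k * μ - (J + k * μ)) ^ 2 +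
        ((J : ℝ) + k * ν - (J + k * ν)) ^ 2 + 2 * k) / (J : ℝ) ^ 2 := by
      rw [sub_self, sub_self, le_sub_comm, div_le_iff₀ (by positivity)]
      linarith
    have h2 : Real.exp (-(J : ℝ)) ≤ 1 / 2 := by
      rw [Real.exp_neg, one_div]
      refine inv_anti₀ two_pos ?_
      have : (1 : ℝ) ≤ J := by exact_mod_cast hJ
      linarith [Real.add_one_le_exp (J : ℝ)]
    calc inventory S a b ^ k * Real.exp (-(J * (a + b + 1)))
        = Real.exp (-(2 * J * (a + b))) * inventory S a b ^ k * Real.exp (a * J + b * J) *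
          Real.exp (-(J : ℝ)) := by
          have : Real.exp (-(J * (a + b + 1))) = Real.exp (-(2 * J * (a + b))) *
              Real.exp (a * J + b * J) * Real.exp (-(J : ℝ)) := by
            rw [← Real.exp_add, ← Real.exp_add]; congr 1; ring
          rw [this]; ring
      _ ≤ _ := mul_le_mul_of_nonneg_left (h2.trans h1) (by positivity)
  · intro z
    by_cases hψ : 0 < 1 - ((z.1 - (J + k * μ)) ^ 2 + (z.2 - (J + k * ν)) ^ 2) / (J : ℝ) ^ 2
    · rw [sub_pos, div_lt_one (by positivity)] at hψ
      have hx : |z.1 - (J + k * μ)| ≤ J :=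
        abs_le_of_sq_le_sq (by nlinarith [sq_nonneg (z.2 - (J + k * ν))]) hJ0.le
      have hy : |z.2 - (J + k * ν)| ≤ J :=
        abs_le_of_sq_le_sq (by nlinarith [sq_nonneg (z.1 - (J + k * μ))]) hJ0.le
      rw [abs_le] at hx hy
      have hkμ : 0 ≤ k * μ := by positivity
      have hkν : 0 ≤ k * ν := by positivity
      have hz : z ∈ Quadrant := ⟨by linarith, by linarith⟩
      rw [Set.indicator_of_mem hz]
      have hax : a * z.1 ≤ a * (2 * J) + k * (a * μ) := by
        nlinarith [mul_le_mul_of_nonneg_left hx.2 ha]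
      have hby : b * z.2 ≤ b * (2 * J) + k * (b * ν) := by
        nlinarith [mul_le_mul_of_nonneg_left hy.2 hb]
      rw [haμ] at hax
      rw [hbν] at hby
      refine mul_le_one₀ ?_ ?_ ?_
      · rw [← Real.exp_add, Real.exp_le_one_iff]
        linarith
      · rw [sub_nonneg, div_le_one (by positivity)]
        exact hψ.le
      · exact sub_le_self _ (by positivity)
    · refine le_trans (mul_nonpos_of_nonneg_of_nonpos (by positivity) (not_lt.1 hψ)) ?_
      exact Set.indicator_nonneg (fun _ _ => zero_le_one) _

/-- Lower bound for quadrant growth at a point satisfying the first-order conditions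
for minimising the inventory over the quadrant. -/
lemma inventory_le_walkGrowth_Quadrant (hS : ∀ s, |(S s).1| ≤ 1 ∧ |(S s).2| ≤ 1) {c : ℕ}
    (hc : HasDiagonalWord S c) {a b : ℝ} (ha : 0 ≤ a) (hb : 0 ≤ b)
    (hμ0 : 0 ≤ ∑ s, Real.exp (a * (S s).1 + b * (S s).2) * (S s).1)
    (hν0 : 0 ≤ ∑ s, Real.exp (a * (S s).1 + b * (S s).2) * (S s).2)
    (haμ : a * ∑ s, Real.exp (a * (S s).1 + b * (S s).2) * (S s).1 = 0)
    (hbν : b * ∑ s, Real.exp (a * (S s).1 + b * (S s).2) * (S s).2 = 0) :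
    inventory S a b ≤ walkGrowth (walkCount S Quadrant) := by
  set m := inventory S a b with hm
  set μ := ∑ s, Real.exp (a * (S s).1 + b * (S s).2) * (S s).1 with hμ
  set ν := ∑ s, Real.exp (a * (S s).1 + b * (S s).2) * (S s).2 with hν
  have hS' : ∀ s, -1 ≤ (S s).1 ∧ -1 ≤ (S s).2 := fun s =>
    ⟨(abs_le.1 (hS s).1).1, (abs_le.1 (hS s).2).1⟩
  have hmnn : 0 ≤ m := Finset.sum_nonneg fun s _ => (Real.exp_pos _).le
  rcases hmnn.eq_or_lt with hm0 | hmpos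
  · rw [← hm0]
    refine Filter.le_limsup_of_frequently_le (Filter.Eventually.frequently
      (Filter.Eventually.of_forall fun n => by positivity))
      (isBoundedUnder_root (Nat.cast_nonneg _) (walkCount_le_card_pow S _))
  set A := a + b + 1 with hA
  set l := Real.log m with hl
  have hlow : ∀ N : ℕ, 0 < N →
      Real.exp ((4 * N ^ 2 * l - 4 * N * A) * N) ≤
        walkCount S Quadrant (4 * N * (N + c) ^ 2) := by
    intro N hN
    have h1 := inventory_pow_le_transfer_iterate hS (μ := μ / m) (ν := ν / m)
      (k := 4 * N ^ 2) (J := 4 * N) ha hb (by positivity) (by positivity)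
      (by rw [mul_div_assoc', haμ, zero_div]) (by rw [mul_div_assoc', hbν, zero_div])
      (by rw [mul_div_cancel₀ _ hmpos.ne']) (by rw [mul_div_cancel₀ _ hmpos.ne'])
      (by positivity) (le_of_eq (by ring))
    have h2 := h1.trans (le_endCount hc (4 * N ^ 2) (4 * N))
    have h3 := (pow_le_pow_left₀ (by positivity) h2 N).trans
      (endCount_pow_le_walkCount hS' hc (c * (4 * N) + 4 * N ^ 2) N)
    have h4 : c * (c * (4 * N) + 4 * N ^ 2) + (c * (4 * N) + 4 * N ^ 2) * N =
        4 * N * (N + c) ^ 2 := by ring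
    rw [h4] at h3
    refine le_trans (le_of_eq ?_) h3
    rw [mul_comm (4 * (N : ℝ) ^ 2 * l - 4 * N * A), Real.exp_nat_mul, ← hm,
      ← Real.exp_log (pow_pos hmpos _), ← Real.exp_add, Real.log_pow]
    congr 2
    push_cast
    ring
  have ht : Filter.Tendsto (fun N : ℕ => (N : ℝ) / (N + c)) Filter.atTop (nhds 1) :=
    tendsto_natCast_div_add_atTop (c : ℝ)
  have hs : Filter.Tendsto (fun N : ℕ => ((N : ℝ) + c)⁻¹) Filter.atTop (nhds 0) :=
    (Filter.tendsto_atTop_add_const_right _ _ tendsto_natCast_atTop_atTop).inv_tendsto_atTop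
  have hu : Filter.Tendsto (fun N : ℕ => Real.exp (l * ((N : ℝ) / (N + c)) ^ 2 -
      A * ((N : ℝ) / (N + c)) * ((N : ℝ) + c)⁻¹)) Filter.atTop (nhds m) := by
    have := (((ht.pow 2).const_mul l).sub ((ht.const_mul A).mul hs)).rexp
    simpa [hl, Real.exp_log hmpos] using this
  have hφ : Filter.Tendsto (fun N : ℕ => 4 * N * (N + c) ^ 2) Filter.atTop Filter.atTop := by
    refine Filter.tendsto_atTop_mono' _ ?_ Filter.tendsto_id
    filter_upwards [Filter.eventually_ge_atTop 1] with N hN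
    have : 1 ≤ (N + c) ^ 2 := Nat.one_le_pow _ _ (by omega)
    rw [id]
    nlinarith
  refine le_walkGrowth_of_tendsto (Nat.cast_nonneg _) (walkCount_le_card_pow S _) hφ hu ?_
  filter_upwards [Filter.eventually_ge_atTop 1] with N hN
  refine le_trans (le_of_eq ?_) (Real.rpow_le_rpow (Real.exp_pos _).le (hlow N hN) (by positivity))
  have hN' : (0 : ℝ) < N := by exact_mod_cast hN
  rw [← Real.exp_mul]
  congr 1
  push_cast
  field_simp

end Quadrant

section Minimiser

variable {ι : Type} [Fintype ι] {S : ι → ℤ × ℤ}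

/-- A derivative at a minimiser over `[0, ∞)` is nonnegative, and vanishes in the interior. -/
lemma deriv_nonneg_of_isMinOn_Ici {φ : ℝ → ℝ} {a d : ℝ} (ha : 0 ≤ a) (hd : HasDerivAt φ d a)
    (hmin : ∀ t, 0 ≤ t → φ a ≤ φ t) : 0 ≤ d ∧ a * d = 0 := by
  constructor
  · have h := hd.hasDerivWithinAt (s := Set.Ioi a)
    rw [hasDerivWithinAt_iff_tendsto_slope' (by simp)] at h
    refine ge_of_tendsto h ?_
    filter_upwards [self_mem_nhdsWithin] with t ht
    rw [slope_def_field]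
    exact div_nonneg (sub_nonneg.2 (hmin t (ha.trans (le_of_lt ht)))) (sub_nonneg.2 (le_of_lt ht))
  · rcases ha.eq_or_lt with h | h
    · rw [← h, zero_mul]
    · have hloc : IsLocalMin φ a := by
        filter_upwards [lt_mem_nhds h] with t ht
        exact hmin t ht.le
      rw [hloc.hasDerivAt_eq_zero hd, mul_zero]

lemma hasDerivAt_inventory_left (S : ι → ℤ × ℤ) (a b : ℝ) :
    HasDerivAt (fun a => inventory S a b)
      (∑ s, Real.exp (a * (S s).1 + b * (S s).2) * (S s).1) a := by
  refine HasDerivAt.fun_sum fun s _ => ?_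
  simpa using (((hasDerivAt_id a).mul_const ((S s).1 : ℝ)).add_const (b * (S s).2)).exp

lemma hasDerivAt_inventory_right (S : ι → ℤ × ℤ) (a b : ℝ) :
    HasDerivAt (fun b => inventory S a b)
      (∑ s, Real.exp (a * (S s).1 + b * (S s).2) * (S s).2) b := by
  refine HasDerivAt.fun_sum fun s _ => ?_
  simpa using (((hasDerivAt_id b).mul_const ((S s).2 : ℝ)).const_add (a * (S s).1)).exp

lemma HasDiagonalWord.exp_le {c : ℕ} (hc : HasDiagonalWord S c) (a b : ℝ) :
    Real.exp (a + b) ≤ inventory S a b ^ c := by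
  have h1 := hc (fun z => Real.exp (a * z.1 + b * z.2)) (fun z => (Real.exp_pos _).le) 0
    ⟨le_rfl, le_rfl⟩
  have h2 := h1.trans (transfer_iterate_exp_le a b c 0)
  simpa using h2

lemma continuous_inventory (S : ι → ℤ × ℤ) :
    Continuous fun p : ℝ × ℝ => inventory S p.1 p.2 := by
  unfold inventory
  fun_prop

lemma HasDiagonalWord.exists_inventory_min {c : ℕ} (hc : HasDiagonalWord S c) :
    ∃ a b : ℝ, 0 ≤ a ∧ 0 ≤ b ∧
      ∀ a' b' : ℝ, 0 ≤ a' → 0 ≤ b' → inventory S a b ≤ inventory S a' b' := by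
  set B := inventory S 0 0 with hB
  set r := B ^ c with hr
  have hnn : ∀ a b, 0 ≤ inventory S a b := fun a b =>
    Finset.sum_nonneg fun s _ => (Real.exp_pos _).le
  have hr0 : 0 ≤ r := pow_nonneg (hnn 0 0) c
  obtain ⟨p, hp, hmin⟩ := (isCompact_Icc (a := ((0 : ℝ), (0 : ℝ))) (b := (r, r))).exists_isMinOn
    ⟨(0, 0), Set.left_mem_Icc.2 ⟨hr0, hr0⟩⟩ (continuous_inventory S).continuousOn
  refine ⟨p.1, p.2, hp.1.1, hp.1.2, fun a b ha hb => ?_⟩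
  by_cases hab : a ≤ r ∧ b ≤ r
  · exact hmin (show (a, b) ∈ _ from ⟨⟨ha, hb⟩, hab⟩)
  · have h0 : inventory S p.1 p.2 ≤ B := hmin (Set.left_mem_Icc.2 ⟨hr0, hr0⟩)
    refine h0.trans (le_of_not_gt fun hlt => ?_)
    have h1 := (hc.exp_le a b).trans (pow_le_pow_left₀ (hnn a b) hlt.le c)
    have h2 := Real.add_one_le_exp (a + b)
    exact hab ⟨by linarith, by linarith⟩

lemma HasDiagonalWord.exists_walkGrowth_Hplane_le (hS : ∀ s, |(S s).1| ≤ 1 ∧ |(S s).2| ≤ 1)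
    {c : ℕ} (hc : HasDiagonalWord S c) :
    ∃ θ ∈ Set.Icc 0 (Real.pi / 2),
      walkGrowth (walkCount S (Hplane θ)) ≤ walkGrowth (walkCount S Quadrant) := by
  obtain ⟨a, b, ha, hb, hmin⟩ := hc.exists_inventory_min
  have h1 := deriv_nonneg_of_isMinOn_Ici ha (hasDerivAt_inventory_left S a b)
    fun t ht => hmin t b ht hb
  have h2 := deriv_nonneg_of_isMinOn_Ici hb (hasDerivAt_inventory_right S a b)
    fun t ht => hmin a t ha ht
  have hlow := inventory_le_walkGrowth_Quadrant hS hc ha hb h1.1 h2.1 h1.2 h2.2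
  let z : ℂ := ⟨b, a⟩
  refine ⟨z.arg, ⟨Complex.arg_nonneg_iff.2 ha,
    (abs_le.1 (Complex.abs_arg_le_pi_div_two_iff.2 hb)).2⟩, le_trans ?_ hlow⟩
  refine (walkGrowth_Hplane_le_inventory S (norm_nonneg z)).trans_eq ?_
  rw [Complex.norm_mul_sin_arg, Complex.norm_mul_cos_arg]

end Minimiser

section Words

variable {ι : Type} [Fintype ι] {S : ι → ℤ × ℤ}

lemma le_transfer_of_mem {z : ℝ × ℝ} {s : ι} {f : ℝ × ℝ → ℝ} (hf : ∀ z, 0 ≤ f z)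
    (hs : z + (((S s).1 : ℝ), ((S s).2 : ℝ)) ∈ Quadrant) :
    f (z + (((S s).1 : ℝ), ((S s).2 : ℝ))) ≤ transfer S Quadrant f z := by
  classical
  rw [transfer]
  refine le_trans (le_of_eq (if_pos hs).symm) (Finset.single_le_sum (f := fun s =>
    if z + (((S s).1 : ℝ), ((S s).2 : ℝ)) ∈ Quadrant
      then f (z + (((S s).1 : ℝ), ((S s).2 : ℝ))) else 0) (fun t _ => ?_) (Finset.mem_univ s))
  split_ifs
  · exact hf _
  · exact le_rfl

lemma transfer_nonneg {R : Set (ℝ × ℝ)} {f : ℝ × ℝ → ℝ} (hf : ∀ z, 0 ≤ f z) (z : ℝ × ℝ) :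
    0 ≤ transfer S R f z :=
  transfer_iterate_nonneg hf 1 z

lemma hasDiagonalWord_one {s : ι} (hs : S s = (1, 1)) : HasDiagonalWord S 1 := by
  intro f hf z hz
  have h := le_transfer_of_mem (S := S) (z := z) (s := s) hf
  simp only [hs, Int.cast_one] at h
  exact h (add_diag_mem_Quadrant hz zero_le_one)

lemma hasDiagonalWord_two {s t : ι} (hs : S s = (1, 0)) (ht : S t = (0, 1)) :
    HasDiagonalWord S 2 := by
  intro f hf z hz
  have h1 := le_transfer_of_mem (S := S) (z := z) (s := s)
    (transfer_nonneg (S := S) (R := Quadrant) hf)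
  have h2 := le_transfer_of_mem (S := S) (z := z + (1, 0)) (s := t) hf
  simp only [hs, ht, Int.cast_one, Int.cast_zero] at h1 h2
  have e : z + (1, 0) + (0, 1) = z + (1, 1) := by
    simp only [add_assoc]
    refine congrArg (z + ·) ?_
    norm_num
  rw [e] at h2
  refine (h2 (add_diag_mem_Quadrant hz zero_le_one)).trans (h1 ⟨?_, ?_⟩)
  · exact add_nonneg hz.1 zero_le_one
  · exact add_nonneg hz.2 le_rfl

lemma hasDiagonalWord_three_left {s t : ι} (hs : S s = (1, 0)) (ht : S t = (-1, 1)) :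
    HasDiagonalWord S 3 := by
  intro f hf z hz
  have hf1 := transfer_nonneg (S := S) (R := Quadrant) hf
  have h1 := le_transfer_of_mem (S := S) (z := z) (s := s)
    (transfer_nonneg (S := S) (R := Quadrant) hf1)
  have h2 := le_transfer_of_mem (S := S) (z := z + (1, 0)) (s := s) hf1
  have h3 := le_transfer_of_mem (S := S) (z := z + (1, 0) + (1, 0)) (s := t) hf
  simp only [hs, ht, Int.cast_one, Int.cast_zero, Int.cast_neg] at h1 h2 h3
  have e : z + (1, 0) + (1, 0) + (-1, 1) = z + (1, 1) := by
    simp only [add_assoc]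
    refine congrArg (z + ·) ?_
    norm_num
  rw [e] at h3
  have q1 : z + (1, 0) ∈ Quadrant := ⟨add_nonneg hz.1 zero_le_one, add_nonneg hz.2 le_rfl⟩
  have q2 : z + (1, 0) + (1, 0) ∈ Quadrant :=
    ⟨add_nonneg q1.1 zero_le_one, add_nonneg q1.2 le_rfl⟩
  exact ((h3 (add_diag_mem_Quadrant hz zero_le_one)).trans (h2 q2)).trans (h1 q1)

lemma hasDiagonalWord_three_right {s t : ι} (hs : S s = (0, 1)) (ht : S t = (1, -1)) :
    HasDiagonalWord S 3 := by
  intro f hf z hz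
  have hf1 := transfer_nonneg (S := S) (R := Quadrant) hf
  have h1 := le_transfer_of_mem (S := S) (z := z) (s := s)
    (transfer_nonneg (S := S) (R := Quadrant) hf1)
  have h2 := le_transfer_of_mem (S := S) (z := z + (0, 1)) (s := s) hf1
  have h3 := le_transfer_of_mem (S := S) (z := z + (0, 1) + (0, 1)) (s := t) hf
  simp only [hs, ht, Int.cast_one, Int.cast_zero, Int.cast_neg] at h1 h2 h3
  have e : z + (0, 1) + (0, 1) + (1, -1) = z + (1, 1) := by
    simp only [add_assoc]
    refine congrArg (z + ·) ?_
    norm_num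
  rw [e] at h3
  have q1 : z + (0, 1) ∈ Quadrant := ⟨add_nonneg hz.1 le_rfl, add_nonneg hz.2 zero_le_one⟩
  have q2 : z + (0, 1) + (0, 1) ∈ Quadrant :=
    ⟨add_nonneg q1.1 le_rfl, add_nonneg q1.2 zero_le_one⟩
  exact ((h3 (add_diag_mem_Quadrant hz zero_le_one)).trans (h2 q2)).trans (h1 q1)

end Words

section Degenerate

variable {ι : Type} [Fintype ι] {S : ι → ℤ × ℤ}

/-- The two diagonal steps `(1, 1)` and `(-1, -1)`. -/
def diagonalSteps (b : Bool) : ℤ × ℤ := if b then (1, 1) else (-1, -1)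

lemma two_le_walkGrowth_diagonalSteps : 2 ≤ walkGrowth (walkCount diagonalSteps Quadrant) := by
  have hc : HasDiagonalWord diagonalSteps 1 := hasDiagonalWord_one (s := true) rfl
  have h := inventory_le_walkGrowth_Quadrant (S := diagonalSteps) (by simp [diagonalSteps]) hc
    (a := 0) (b := 0) le_rfl le_rfl (by simp [diagonalSteps]) (by simp [diagonalSteps])
    (zero_mul _) (zero_mul _)
  have e : inventory diagonalSteps 0 0 = 2 := by simp [inventory]
  rwa [e] at h

lemma two_le_walkGrowth_Quadrant {k₁ k₂ : ι} (hne : k₁ ≠ k₂)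
    (h₁ : 0 ≤ (S k₁).1 ∧ 0 ≤ (S k₁).2) (h₂ : S k₂ = -S k₁) :
    2 ≤ walkGrowth (walkCount S Quadrant) := by
  refine two_le_walkGrowth_diagonalSteps.trans
    (walkGrowth_mono (Nat.cast_nonneg _) (fun n => ?_) (walkCount_le_card_pow S _))
  let e : Bool → ι := fun b => if b then k₁ else k₂
  have he : Function.Injective e := by
    intro b b' h
    cases b <;> cases b' <;> simp_all [e, eq_comm]
  have e1 : ∀ b, ((S (e b)).1 : ℝ) = (diagonalSteps b).1 * (S k₁).1 := by
    intro b
    cases b <;> simp [e, diagonalSteps, h₂]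
  have e2 : ∀ b, ((S (e b)).2 : ℝ) = (diagonalSteps b).2 * (S k₁).2 := by
    intro b
    cases b <;> simp [e, diagonalSteps, h₂]
  have hw : ∀ w : Fin n → Bool, IsWalkIn diagonalSteps Quadrant w →
      IsWalkIn S Quadrant (e ∘ w) := by
    intro w hw m
    refine ⟨?_, ?_⟩
    · simp only [Function.comp_apply, e1, ← ite_zero_mul]
      rw [← Finset.sum_mul]
      exact mul_nonneg (hw m).1 (by exact_mod_cast h₁.1)
    · simp only [Function.comp_apply, e2, ← ite_zero_mul]
      rw [← Finset.sum_mul]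
      exact mul_nonneg (hw m).2 (by exact_mod_cast h₁.2)
  exact Nat.card_le_card_of_injective
    (fun w : {w : Fin n → Bool // IsWalkIn diagonalSteps Quadrant w} =>
      (⟨e ∘ w.1, hw _ w.2⟩ : {w : Fin n → ι // IsWalkIn S Quadrant w}))
    fun w w' h => Subtype.ext (he.comp_left (congrArg Subtype.val h))

lemma walkGrowth_Hplane_le_two {θ : ℝ} {k₁ k₂ : ι} (h₁ : Atheta S θ k₁ = 0)
    (h₂ : Atheta S θ k₂ = 0) (hneg : ∀ s, s = k₁ ∨ s = k₂ ∨ Atheta S θ s < 0) :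
    walkGrowth (walkCount S (Hplane θ)) ≤ 2 := by
  classical
  have hlim : Filter.Tendsto (fun r : ℝ => ∑ s, Real.exp (r * Atheta S θ s)) Filter.atTop
      (nhds (∑ s, if s = k₁ ∨ s = k₂ then 1 else 0)) := by
    refine tendsto_finsetSum _ fun s _ => ?_
    split_ifs with hs
    · have : Atheta S θ s = 0 := by rcases hs with rfl | rfl <;> assumption
      simp [this]
    · have : Atheta S θ s < 0 := by
        rcases hneg s with h | h | h
        · exact absurd (Or.inl h) hs
        · exact absurd (Or.inr h) hs
        · exact h
      exact Real.tendsto_exp_atBot.comp (Filter.tendsto_id.atTop_mul_const_of_neg this)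
  have hle : (∑ s, if s = k₁ ∨ s = k₂ then (1 : ℝ) else 0) ≤ 2 := by
    rw [Finset.sum_boole]
    have h : (Finset.univ.filter fun s => s = k₁ ∨ s = k₂) ⊆ {k₁, k₂} := fun s hs => by
      simpa using hs
    exact_mod_cast (Finset.card_le_card h).trans Finset.card_le_two
  refine (ge_of_tendsto hlim ?_).trans hle
  filter_upwards [Filter.eventually_ge_atTop 0] with r hr
  refine (walkGrowth_Hplane_le_inventory S hr).trans_eq (Finset.sum_congr rfl fun s _ => ?_)
  rw [Atheta]
  congr 1
  ring

/-- A walk whose `g`-steps are nonpositive, whose `g`-height is nonnegative at time `m` and whose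
`f`-height vanishes at time `m` uses a step with `g = 0` and `f < 0`. -/
lemma exists_neg_of_sum_eq_zero {ι : Type} {f g : ι → ℝ} (hg : ∀ s, g s ≤ 0)
    (hfg : ∀ s, f s = 0 → g s ≠ 0) {n : ℕ} {w : Fin n → ι} {m : Fin n}
    (hf0 : (∑ i : Fin n, if i ≤ m then f (w i) else 0) = 0)
    (hg0 : 0 ≤ ∑ i : Fin n, if i ≤ m then g (w i) else 0) : ∃ s, g s = 0 ∧ f s < 0 := by
  by_contra! hcon
  rw [← Finset.sum_filter] at hf0 hg0
  have h1 := (Finset.sum_eq_zero_iff_of_nonpos fun i _ => hg (w i)).1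
    (le_antisymm (Finset.sum_nonpos fun i _ => hg (w i)) hg0)
  have h2 := (Finset.sum_eq_zero_iff_of_nonneg fun i hi => hcon (w i) (h1 i hi)).1 hf0
  have hm : m ∈ Finset.univ.filter fun i => i ≤ m := by simp
  exact hfg _ (h2 m hm) (h1 m hm)

end Degenerate

section SmallSteps

variable {ι : Type} [Fintype ι] {S : ι → ℤ × ℤ}

lemma walkGrowth_Hplane_zero_le_of_no_up (hinj : Function.Injective S)
    (hS : ∀ s, |(S s).1| ≤ 1 ∧ |(S s).2| ≤ 1) (hne : ∀ s, S s ≠ (0, 0)) {s : ι}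
    (hs : S s = (1, 0)) (hup : ∀ t, (S t).2 ≤ 0) (hnt : NontrivialQP S) :
    walkGrowth (walkCount S (Hplane 0)) ≤ walkGrowth (walkCount S Quadrant) := by
  obtain ⟨n, w, hw, m, hm⟩ := hnt.2.2
  obtain ⟨t, ht0, ht1⟩ := exists_neg_of_sum_eq_zero (f := fun s => ((S s).1 : ℝ))
    (g := fun s => ((S s).2 : ℝ)) (fun s => by exact_mod_cast hup s)
    (fun s h1 h2 => hne s (Prod.ext (by exact_mod_cast h1) (by exact_mod_cast h2))) hm (hw m).2
  norm_cast at ht0 ht1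
  have ht : S t = (-1, 0) := by
    have := (abs_le.1 (hS t).1).1
    exact Prod.ext (by dsimp only; omega) ht0
  have hst : s ≠ t := fun h => by rw [← h, hs] at ht; simp at ht
  refine (walkGrowth_Hplane_le_two (k₁ := s) (k₂ := t) (by simp [Atheta, hs])
    (by simp [Atheta, ht]) fun u => ?_).trans
    (two_le_walkGrowth_Quadrant hst (by simp [hs]) (by simp [hs, ht]))
  rcases (hup u).lt_or_eq with h | h
  · right; right
    simpa [Atheta] using h
  · have h1 := abs_le.1 (hS u).1
    have h2 : (S u).1 ≠ 0 := fun h0 => hne u (Prod.ext h0 h)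
    rcases (by omega : (S u).1 = 1 ∨ (S u).1 = -1) with h3 | h3
    · left; exact hinj ((Prod.ext h3 h : S u = (1, 0)).trans hs.symm)
    · right; left; exact hinj ((Prod.ext h3 h : S u = (-1, 0)).trans ht.symm)

lemma walkGrowth_Hplane_pi_div_two_le_of_no_right (hinj : Function.Injective S)
    (hS : ∀ s, |(S s).1| ≤ 1 ∧ |(S s).2| ≤ 1) (hne : ∀ s, S s ≠ (0, 0)) {s : ι}
    (hs : S s = (0, 1)) (hright : ∀ t, (S t).1 ≤ 0) (hnt : NontrivialQP S) :
    walkGrowth (walkCount S (Hplane (Real.pi / 2))) ≤ walkGrowth (walkCount S Quadrant) := by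
  obtain ⟨n, w, hw, m, hm⟩ := hnt.2.1
  obtain ⟨t, ht0, ht1⟩ := exists_neg_of_sum_eq_zero (f := fun s => ((S s).2 : ℝ))
    (g := fun s => ((S s).1 : ℝ)) (fun s => by exact_mod_cast hright s)
    (fun s h1 h2 => hne s (Prod.ext (by exact_mod_cast h2) (by exact_mod_cast h1))) hm (hw m).1
  norm_cast at ht0 ht1
  have ht : S t = (0, -1) := by
    have := (abs_le.1 (hS t).2).1
    exact Prod.ext ht0 (by dsimp only; omega)
  have hst : s ≠ t := fun h => by rw [← h, hs] at ht; simp at ht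
  refine (walkGrowth_Hplane_le_two (k₁ := s) (k₂ := t) (by simp [Atheta, hs])
    (by simp [Atheta, ht]) fun u => ?_).trans
    (two_le_walkGrowth_Quadrant hst (by simp [hs]) (by simp [hs, ht]))
  rcases (hright u).lt_or_eq with h | h
  · right; right
    simpa [Atheta] using h
  · have h1 := abs_le.1 (hS u).2
    have h2 : (S u).2 ≠ 0 := fun h0 => hne u (Prod.ext h h0)
    rcases (by omega : (S u).2 = 1 ∨ (S u).2 = -1) with h3 | h3
    · left; exact hinj ((Prod.ext h h3 : S u = (0, 1)).trans hs.symm)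
    · right; left; exact hinj ((Prod.ext h h3 : S u = (0, -1)).trans ht.symm)

lemma NontrivialQP.exists_step_mem {ι : Type} {S : ι → ℤ × ℤ} (hnt : NontrivialQP S) :
    ∃ s, 0 ≤ (S s).1 ∧ 0 ≤ (S s).2 := by
  obtain ⟨⟨n, hn, w, hw⟩, -⟩ := hnt
  obtain ⟨n, rfl⟩ := Nat.exists_eq_succ_of_ne_zero hn.ne'
  have h := hw 0
  refine ⟨w 0, ?_, ?_⟩
  · have := h.1
    simpa [Fin.sum_univ_succ, Fin.le_zero_iff, Fin.succ_ne_zero] using this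
  · have := h.2
    simpa [Fin.sum_univ_succ, Fin.le_zero_iff, Fin.succ_ne_zero] using this

lemma exists_walkGrowth_Hplane_le (hinj : Function.Injective S)
    (hS : ∀ s, |(S s).1| ≤ 1 ∧ |(S s).2| ≤ 1) (hne : ∀ s, S s ≠ (0, 0))
    (hnt : NontrivialQP S) :
    ∃ θ ∈ Set.Icc 0 (Real.pi / 2),
      walkGrowth (walkCount S (Hplane θ)) ≤ walkGrowth (walkCount S Quadrant) := by
  have hpi : 0 ≤ Real.pi / 2 := Real.pi_div_two_pos.le
  by_cases hword : ∃ c, HasDiagonalWord S c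
  · obtain ⟨c, hc⟩ := hword
    exact hc.exists_walkGrowth_Hplane_le hS
  have h11 : ∀ t, S t ≠ (1, 1) := fun t ht => hword ⟨1, hasDiagonalWord_one ht⟩
  obtain ⟨s, hs1, hs2⟩ := hnt.exists_step_mem
  have hs1' := (abs_le.1 (hS s).1).2
  have hs2' := (abs_le.1 (hS s).2).2
  rcases hs1.eq_or_lt with h1 | h1
  · have hs2'' : (S s).2 ≠ 0 := fun h0 => hne s (Prod.ext h1.symm h0)
    have hs : S s = (0, 1) := Prod.ext h1.symm (by dsimp only; omega)
    refine ⟨Real.pi / 2, ⟨hpi, le_rfl⟩,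
      walkGrowth_Hplane_pi_div_two_le_of_no_right hinj hS hne hs (fun t => ?_) hnt⟩
    by_contra! ht
    have ht1 : (S t).1 = 1 := le_antisymm (abs_le.1 (hS t).1).2 ht
    have ht2 := abs_le.1 (hS t).2
    rcases (by omega : (S t).2 = 1 ∨ (S t).2 = 0 ∨ (S t).2 = -1) with h | h | h
    · exact h11 t (Prod.ext ht1 h)
    · exact hword ⟨2, hasDiagonalWord_two (s := t) (Prod.ext ht1 h) hs⟩
    · exact hword ⟨3, hasDiagonalWord_three_right hs (t := t) (Prod.ext ht1 h)⟩
  · have hs1'' : (S s).1 = 1 := by omega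
    have hs2'' : (S s).2 ≠ 1 := fun h0 => h11 s (Prod.ext hs1'' h0)
    have hs : S s = (1, 0) := Prod.ext hs1'' (by dsimp only; omega)
    refine ⟨0, ⟨le_rfl, hpi⟩,
      walkGrowth_Hplane_zero_le_of_no_up hinj hS hne hs (fun t => ?_) hnt⟩
    by_contra! ht
    have ht1 : (S t).2 = 1 := le_antisymm (abs_le.1 (hS t).2).2 ht
    have ht2 := abs_le.1 (hS t).1
    rcases (by omega : (S t).1 = 1 ∨ (S t).1 = 0 ∨ (S t).1 = -1) with h | h | h
    · exact h11 t (Prod.ext h ht1)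
    · exact hword ⟨2, hasDiagonalWord_two hs (t := t) (Prod.ext h ht1)⟩
    · exact hword ⟨3, hasDiagonalWord_three_left hs (t := t) (Prod.ext h ht1)⟩

end SmallSteps

/-- For a finite set `S ⊆ {−1,0,1}² \ {(0,0)}` of small steps defining
a nontrivial quarter-plane model, the growth constant of the quarter-plane counting
sequence equals the minimum over `θ ∈ [0, π/2]` of the half-plane growth constants:
`K_S = min_{θ ∈ [0,π/2]} K_S(θ)`. -/
theorem small_step_growth_eq_min_hplane {ι : Type} [Fintype ι] (S : ι → ℤ × ℤ)
    (hinj : Function.Injective S)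
    (hsmall : ∀ k, (S k).1 ∈ ({-1, 0, 1} : Set ℤ) ∧ (S k).2 ∈ ({-1, 0, 1} : Set ℤ) ∧
      S k ≠ (0, 0))
    (hnt : NontrivialQP S) :
    ∃ θ₀ ∈ Set.Icc (0 : ℝ) (Real.pi / 2),
      (∀ θ ∈ Set.Icc (0 : ℝ) (Real.pi / 2),
        walkGrowth (walkCount S (Hplane θ₀)) ≤ walkGrowth (walkCount S (Hplane θ))) ∧
      walkGrowth (walkCount S Quadrant) = walkGrowth (walkCount S (Hplane θ₀)) := by
  have hS : ∀ s, |(S s).1| ≤ 1 ∧ |(S s).2| ≤ 1 := fun s => by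
    obtain ⟨h1, h2, -⟩ := hsmall s
    simp only [Set.mem_insert_iff, Set.mem_singleton_iff] at h1 h2
    exact ⟨abs_le.2 (by omega), abs_le.2 (by omega)⟩
  obtain ⟨θ₀, hθ₀, hle⟩ := exists_walkGrowth_Hplane_le hinj hS (fun s => (hsmall s).2.2) hnt
  exact ⟨θ₀, hθ₀, fun θ hθ => hle.trans (walkGrowth_Quadrant_le S hθ),
    le_antisymm (walkGrowth_Quadrant_le S hθ₀) hle⟩
end

section
/- (Shuffle Lemma) Let S₁ and S₂ be finite multisets of vectors in ℤ², and let K_{S₁} and K_{S₂} be the growth constants of their quarter-plane counting sequences. Then the quarter-plane model on the multiset union S₁ ⊎ S₂ satisfies K_{S₁} + K_{S₂} ≤ K_{S₁ ⊎ S₂}. -/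
open scoped BigOperators

/-- The number of walks of length `n` on `S` starting at `p` all of whose later positions lie in
the first quadrant of `ℤ²`. -/
def pathCount {ι : Type} [Fintype ι] (S : ι → ℤ × ℤ) : ℕ → ℤ × ℤ → ℕ
  | 0, _ => 1
  | n + 1, p => ∑ s, if 0 ≤ p + S s then pathCount S n (p + S s) else 0

section PathCount

variable {ι ι₁ ι₂ : Type} [Fintype ι] [Fintype ι₁] [Fintype ι₂]

theorem natCard_walks_from (S : ι → ℤ × ℤ) (n : ℕ) (p : ℤ × ℤ) :
    Nat.card {w : Fin n → ι // ∀ m : Fin n, 0 ≤ p + ∑ i, if i ≤ m then S (w i) else 0} =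
      pathCount S n p := by
  induction n generalizing p with
  | zero => simp [pathCount]
  | succ n ih =>
    let P : (Fin (n + 1) → ι) → Prop := fun w =>
      ∀ m : Fin (n + 1), 0 ≤ p + ∑ i, if i ≤ m then S (w i) else 0
    have hP : ∀ s w, P (Fin.cons s w) ↔
        0 ≤ p + S s ∧ ∀ m : Fin n, 0 ≤ (p + S s) + ∑ i, if i ≤ m then S (w i) else 0 := by
      intro s w
      simp [P, Fin.forall_fin_succ, Fin.sum_univ_succ, add_assoc]
    let e : {w // P w} ≃ Σ s, {w : Fin n → ι // P (Fin.cons s w)} :=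
      { toFun := fun w => ⟨w.1 0, Fin.tail w.1, by rw [Fin.cons_self_tail]; exact w.2⟩
        invFun := fun x => ⟨Fin.cons x.1 x.2.1, x.2.2⟩
        left_inv := fun w => by simp
        right_inv := fun _ => rfl }
    rw [pathCount, show Nat.card _ = _ from Nat.card_congr e, Nat.card_sigma]
    refine Finset.sum_congr rfl fun s _ => ?_
    split_ifs with hs
    · rw [← ih]
      exact Nat.card_congr (Equiv.subtypeEquivRight fun w => by simp [hP, hs])
    · have : IsEmpty {w : Fin n → ι // P (Fin.cons s w)} := ⟨fun w => hs ((hP _ _).1 w.2).1⟩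
      exact Nat.card_of_isEmpty

theorem walkCount_quadrant (S : ι → ℤ × ℤ) (n : ℕ) :
    walkCount S Quadrant n = pathCount S n 0 := by
  rw [← natCard_walks_from, walkCount]
  refine Nat.card_congr (Equiv.subtypeEquivRight fun w => forall_congr' fun m => ?_)
  simp only [Quadrant, Set.mem_ofPred_eq, zero_add, Prod.le_def, Prod.fst_sum, Prod.snd_sum,
    Prod.fst_zero, Prod.snd_zero, apply_ite Prod.fst, apply_ite Prod.snd]
  norm_cast

theorem pathCount_mono (S : ι → ℤ × ℤ) (n : ℕ) : Monotone (pathCount S n) := by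
  induction n with
  | zero => intro p q _; rfl
  | succ n ih =>
    intro p q hpq
    refine Finset.sum_le_sum fun s _ => ?_
    have h : p + S s ≤ q + S s := by gcongr
    split_ifs with h₁ h₂
    · exact ih h
    · exact absurd (h₁.trans h) h₂
    · exact Nat.zero_le _
    · rfl

theorem pathCount_mul_le (S : ι → ℤ × ℤ) (m n : ℕ) {p : ℤ × ℤ} (hp : 0 ≤ p) :
    pathCount S m p * pathCount S n 0 ≤ pathCount S (m + n) p := by
  induction m generalizing p with
  | zero => simpa [pathCount] using pathCount_mono S n hp
  | succ m ih =>
    rw [Nat.succ_add, pathCount, pathCount, Finset.sum_mul]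
    refine Finset.sum_le_sum fun s _ => ?_
    split_ifs with h
    · exact ih h
    · simp

theorem pathCount_le_card_pow (S : ι → ℤ × ℤ) (n : ℕ) (p : ℤ × ℤ) :
    pathCount S n p ≤ Fintype.card ι ^ n := by
  induction n generalizing p with
  | zero => simp [pathCount]
  | succ n ih =>
    rw [pathCount, pow_succ', ← smul_eq_mul, ← Finset.card_univ]
    refine Finset.sum_le_card_nsmul _ _ _ fun s _ => ?_
    split_ifs
    · exact ih _
    · exact Nat.zero_le _

theorem pathCount_succ_eq_zero {S : ι → ℤ × ℤ} {p : ℤ × ℤ} (h : pathCount S 1 p = 0) (n : ℕ) :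
    pathCount S (n + 1) p = 0 := by
  simp only [pathCount, Finset.sum_eq_zero_iff, Finset.mem_univ, true_imp_iff, ite_eq_right_iff,
    one_ne_zero, imp_false] at h ⊢
  exact fun s hs => absurd hs (h s)

theorem pathCount_shuffle (S₁ : ι₁ → ℤ × ℤ) (S₂ : ι₂ → ℤ × ℤ) (n : ℕ) {p q : ℤ × ℤ}
    (hp : 0 ≤ p) (hq : 0 ≤ q) :
    ∑ ij ∈ Finset.HasAntidiagonal.antidiagonal n,
        n.choose ij.1 * (pathCount S₁ ij.1 p * pathCount S₂ ij.2 q) ≤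
      pathCount (Sum.elim S₁ S₂) n (p + q) := by
  induction n generalizing p q with
  | zero => simp [pathCount]
  | succ n ih =>
    have pascal := Finset.sum_antidiagonal_choose_succ_nsmul
      (fun i j => pathCount S₁ i p * pathCount S₂ j q) n
    simp only [smul_eq_mul] at pascal
    rw [pascal, add_comm, pathCount, Fintype.sum_sum_type]
    refine add_le_add ?_ ?_
    · calc
        _ = ∑ s, if 0 ≤ p + S₁ s then ∑ ij ∈ Finset.HasAntidiagonal.antidiagonal n,
              n.choose ij.1 * (pathCount S₁ ij.1 (p + S₁ s) * pathCount S₂ ij.2 q) else 0 := by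
          simp_rw [pathCount, Finset.sum_mul, Finset.mul_sum]
          rw [Finset.sum_comm]
          refine Finset.sum_congr rfl fun s _ => ?_
          split_ifs
          · refine Finset.sum_congr rfl fun ij hij => ?_
            rw [Nat.choose_symm_of_eq_add (Finset.HasAntidiagonal.mem_antidiagonal.1 hij).symm]
          · simp
        _ ≤ _ := by
          refine Finset.sum_le_sum fun s _ => ?_
          rw [Sum.elim_inl, add_right_comm]
          split_ifs with h₁ h₂
          · exact ih h₁ hq
          · exact absurd (add_nonneg h₁ hq) h₂
          · exact Nat.zero_le _
          · rfl
    · calc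
        _ = ∑ s, if 0 ≤ q + S₂ s then ∑ ij ∈ Finset.HasAntidiagonal.antidiagonal n,
              n.choose ij.1 * (pathCount S₁ ij.1 p * pathCount S₂ ij.2 (q + S₂ s)) else 0 := by
          simp_rw [pathCount, Finset.mul_sum]
          rw [Finset.sum_comm]
          refine Finset.sum_congr rfl fun s _ => ?_
          split_ifs <;> simp
        _ ≤ _ := by
          refine Finset.sum_le_sum fun s _ => ?_
          rw [Sum.elim_inr, add_assoc]
          split_ifs with h₁ h₂
          · exact ih hp h₁
          · exact absurd (add_nonneg hp h₁) h₂
          · exact Nat.zero_le _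
          · rfl

end PathCount

section Growth

variable {h : ℕ → ℕ} {C : ℕ}

theorem rpow_inv_le_of_le_pow (hC : ∀ n, h n ≤ C ^ n) {n : ℕ} (hn : n ≠ 0) :
    (h n : ℝ) ^ ((n : ℝ)⁻¹) ≤ C := by
  rw [Real.rpow_inv_le_iff_of_pos (by positivity) (by positivity) (by positivity)]
  exact_mod_cast hC n

theorem isBoundedUnder_rpow_inv (hC : ∀ n, h n ≤ C ^ n) :
    Filter.IsBoundedUnder (· ≤ ·) Filter.atTop fun n => (h n : ℝ) ^ ((n : ℝ)⁻¹) :=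
  Filter.isBoundedUnder_of_eventually_le <|
    (Filter.eventually_ne_atTop 0).mono fun _ hn => rpow_inv_le_of_le_pow hC hn

theorem isCoboundedUnder_rpow_inv (h : ℕ → ℕ) :
    Filter.IsCoboundedUnder (· ≤ ·) Filter.atTop fun n => (h n : ℝ) ^ ((n : ℝ)⁻¹) :=
  Filter.IsBoundedUnder.isCoboundedUnder_le <|
    Filter.isBoundedUnder_of_eventually_ge (a := 0) <| .of_forall fun _ => by positivity

/-- A supermultiplicative counting sequence that does not vanish after its first term is bounded
below by a multiple of `a ^ n`, for every `a` below its growth constant. -/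
theorem exists_mul_pow_le_of_lt_walkGrowth (h0 : h 0 = 1) (hmul : ∀ m n, h m * h n ≤ h (m + n))
    (h1 : h 1 = 0 → ∀ n, h (n + 1) = 0) {a : ℝ} (ha : 0 < a) (hlt : a < walkGrowth h) :
    ∃ c : ℝ, 0 < c ∧ ∀ n, c * a ^ n ≤ h n := by
  have hfreq := Filter.frequently_lt_of_lt_limsup (isCoboundedUnder_rpow_inv h) hlt
  obtain ⟨N, hN, hN0⟩ := (hfreq.and_eventually (Filter.eventually_ne_atTop 0)).exists
  have haN : a ^ N ≤ h N := by
    have := hN.le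
    rw [Real.le_rpow_inv_iff_of_pos (by positivity) (by positivity) (by positivity)] at this
    exact_mod_cast this
  have hh1 : 1 ≤ h 1 := by
    by_contra! hlt
    obtain ⟨k, rfl⟩ := Nat.exists_eq_succ_of_ne_zero hN0
    rw [Nat.succ_eq_add_one, h1 (by omega) k] at haN
    exact absurd haN (not_le.2 (by push_cast; positivity))
  have hpow : ∀ m k, h m ^ k ≤ h (m * k) := by
    intro m k
    induction k with
    | zero => simp [h0]
    | succ k ih =>
      rw [pow_succ, Nat.mul_succ]
      exact (Nat.mul_le_mul_right _ ih).trans (hmul _ _)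
  have hmod : ∀ n, h N ^ (n / N) ≤ h n := by
    intro n
    calc h N ^ (n / N) ≤ h (N * (n / N)) * h (n % N) := by
          refine (hpow _ _).trans (Nat.le_mul_of_pos_right _ ?_)
          exact (Nat.pow_pos hh1).trans_le ((hpow 1 (n % N)).trans_eq (by rw [one_mul]))
      _ ≤ h n := by simpa [Nat.div_add_mod] using hmul (N * (n / N)) (n % N)
  have hM : 1 ≤ max 1 a := le_max_left _ _
  refine ⟨(max 1 a ^ N)⁻¹, by positivity, fun n => ?_⟩
  have hrem : a ^ (n % N) ≤ max 1 a ^ N :=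
    (pow_le_pow_left₀ ha.le (le_max_right _ _) _).trans
      (pow_le_pow_right₀ hM (Nat.mod_lt _ (Nat.pos_of_ne_zero hN0)).le)
  rw [inv_mul_le_iff₀ (by positivity)]
  calc a ^ n = a ^ (n % N) * (a ^ N) ^ (n / N) := by
        rw [← pow_mul, ← pow_add, Nat.mod_add_div]
    _ ≤ max 1 a ^ N * (h N : ℝ) ^ (n / N) := by gcongr
    _ ≤ max 1 a ^ N * h n := by gcongr; exact_mod_cast hmod n

theorem le_walkGrowth_of_mul_pow_le (hC : ∀ n, h n ≤ C ^ n) {a c : ℝ} (ha : 0 ≤ a) (hc : 0 < c)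
    (hle : ∀ n, c * a ^ n ≤ h n) : a ≤ walkGrowth h := by
  have hlim : Filter.Tendsto (fun n : ℕ => c ^ ((n : ℝ)⁻¹) * a) Filter.atTop (nhds a) := by
    have := (Real.continuousAt_const_rpow hc.ne' (b := 0)).tendsto.comp
      (tendsto_inv_atTop_nhds_zero_nat (𝕜 := ℝ))
    simpa using this.mul_const a
  rw [← hlim.limsup_eq]
  refine Filter.limsup_le_limsup ?_ hlim.isCoboundedUnder_le (isBoundedUnder_rpow_inv hC)
  filter_upwards [Filter.eventually_ne_atTop 0] with n hn
  calc c ^ ((n : ℝ)⁻¹) * a = (c * a ^ n) ^ ((n : ℝ)⁻¹) := by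
        rw [Real.mul_rpow hc.le (by positivity), Real.pow_rpow_inv_natCast ha hn]
    _ ≤ (h n : ℝ) ^ ((n : ℝ)⁻¹) := Real.rpow_le_rpow (by positivity) (hle n) (by positivity)

end Growth

theorem exists_mul_pow_le_pathCount {ι : Type} [Fintype ι] (S : ι → ℤ × ℤ) {ε : ℝ} (hε : 0 < ε) :
    ∃ a c : ℝ, walkGrowth (walkCount S Quadrant) - ε ≤ a ∧ 0 ≤ a ∧ 0 < c ∧
      ∀ n, c * a ^ n ≤ pathCount S n 0 := by
  have hS : walkCount S Quadrant = fun n => pathCount S n 0 := funext (walkCount_quadrant S)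
  rw [hS]
  rcases le_or_gt (walkGrowth fun n => pathCount S n 0) ε with hle | hlt
  · refine ⟨0, 1, by linarith, le_rfl, one_pos, fun n => ?_⟩
    rcases n.eq_zero_or_pos with rfl | hn
    · simp [pathCount]
    · simp [hn.ne']
  · obtain ⟨c, hc, hcle⟩ := exists_mul_pow_le_of_lt_walkGrowth (h := fun n => pathCount S n 0)
      rfl (fun m n => pathCount_mul_le S m n le_rfl) pathCount_succ_eq_zero
      (sub_pos.2 hlt) (sub_lt_self _ hε)
    exact ⟨_, c, le_rfl, (sub_pos.2 hlt).le, hc, hcle⟩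

/-- **Shuffle Lemma.** For finite multisets `S₁, S₂ ⊂ ℤ²` (indexed by
disjoint index types, so that `Sum.elim S₁ S₂` is the multiset union `S₁ ⊎ S₂`), the
quarter-plane growth constants satisfy `K_{S₁} + K_{S₂} ≤ K_{S₁ ⊎ S₂}`. -/
theorem shuffle_lemma {ι₁ ι₂ : Type} [Fintype ι₁] [Fintype ι₂]
    (S₁ : ι₁ → ℤ × ℤ) (S₂ : ι₂ → ℤ × ℤ) :
    walkGrowth (walkCount S₁ Quadrant) + walkGrowth (walkCount S₂ Quadrant) ≤
      walkGrowth (walkCount (Sum.elim S₁ S₂) Quadrant) := by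
  refine le_of_forall_pos_le_add fun ε hε => ?_
  obtain ⟨a, c, ha, ha0, hc, hac⟩ := exists_mul_pow_le_pathCount S₁ (half_pos hε)
  obtain ⟨b, d, hb, hb0, hd, hbd⟩ := exists_mul_pow_le_pathCount S₂ (half_pos hε)
  suffices a + b ≤ walkGrowth (walkCount (Sum.elim S₁ S₂) Quadrant) by linarith
  refine le_walkGrowth_of_mul_pow_le (C := Fintype.card (ι₁ ⊕ ι₂)) (c := c * d)
    (fun n => ?_) (add_nonneg ha0 hb0) (mul_pos hc hd) (fun n => ?_)
  · rw [walkCount_quadrant]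
    exact pathCount_le_card_pow _ n 0
  · have hshuffle := pathCount_shuffle S₁ S₂ n (le_refl 0) (le_refl 0)
    rw [add_zero, ← walkCount_quadrant, ← Nat.cast_le (α := ℝ)] at hshuffle
    refine le_trans ?_ hshuffle
    rw [(Commute.all a b).add_pow', Finset.mul_sum]
    push_cast
    refine Finset.sum_le_sum fun ij _ => ?_
    rw [nsmul_eq_mul]
    calc c * d * (n.choose ij.1 * (a ^ ij.1 * b ^ ij.2))
        = n.choose ij.1 * ((c * a ^ ij.1) * (d * b ^ ij.2)) := by ring
      _ ≤ n.choose ij.1 * (pathCount S₁ ij.1 0 * pathCount S₂ ij.2 0) := by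
          gcongr
          · exact hac _
          · exact hbd _
end

section
/- Let S ⊆ {−1, 0, 1}² \ {(0,0)} be a finite set of small steps defining a nontrivial quarter-plane model, with inventory P(x,y) = Σ_{(i,j)∈S} x^i y^j and drift (δ_x, δ_y) = (P_x(1,1), P_y(1,1)). Suppose δ_x ≥ δ_y > 0 and that (α, β) ∈ (0,∞)² satisfies P_x(α, β) = P_y(α, β) = 0. Then α < 1 and β < 1. -/
open scoped BigOperators

/-- The indicator function of the step set `S`. -/
noncomputable def stepInd {ι : Type} (S : ι → ℤ × ℤ) (p : ℤ × ℤ) : ℤ :=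
  open Classical in if p ∈ Set.range S then 1 else 0

theorem stepInd_eq_zero_or_one {ι : Type} (S : ι → ℤ × ℤ) (p : ℤ × ℤ) :
    stepInd S p = 0 ∨ stepInd S p = 1 := by
  unfold stepInd
  split_ifs <;> simp

theorem sum_steps_eq {ι : Type} [Fintype ι] {S : ι → ℤ × ℤ}
    (hinj : Function.Injective S)
    (hsmall : ∀ k, (S k).1 ∈ ({-1, 0, 1} : Set ℤ) ∧ (S k).2 ∈ ({-1, 0, 1} : Set ℤ))
    (f : ℤ × ℤ → ℝ) :
    ∑ k, f (S k) =
      ∑ i ∈ ({-1, 0, 1} : Finset ℤ), ∑ j ∈ ({-1, 0, 1} : Finset ℤ),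
        (stepInd S (i, j) : ℝ) * f (i, j) := by
  classical
  rw [← Finset.sum_product' (f := fun i j => (stepInd S (i, j) : ℝ) * f (i, j)),
    ← Finset.sum_image (f := f) (s := Finset.univ) (g := S) (fun a _ b _ h => hinj h)]
  have hsub : Finset.univ.image S ⊆ ({-1, 0, 1} : Finset ℤ) ×ˢ ({-1, 0, 1} : Finset ℤ) := by
    intro p hp
    obtain ⟨k, -, rfl⟩ := Finset.mem_image.mp hp
    simpa [Finset.mem_product] using hsmall k
  refine (Finset.sum_congr rfl fun p hp => ?_).trans
    (Finset.sum_subset hsub fun p _ hp => ?_)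
  · have : p ∈ Set.range S := by simpa using hp
    simp [stepInd, this]
  · have : p ∉ Set.range S := by simpa using hp
    simp [stepInd, this]

theorem deriv_Pinv_fst {ι : Type} [Fintype ι] (S : ι → ℤ × ℤ) {x : ℝ} (hx : x ≠ 0) (y : ℝ) :
    deriv (fun x => Pinv S x y) x =
      ∑ k, ((S k).1 : ℝ) * x ^ ((S k).1 - 1) * y ^ (S k).2 :=
  (HasDerivAt.fun_sum fun k _ =>
    (hasDerivAt_zpow (S k).1 x (Or.inl hx)).mul_const (y ^ (S k).2)).deriv

theorem deriv_Pinv_snd {ι : Type} [Fintype ι] (S : ι → ℤ × ℤ) (x : ℝ) {y : ℝ} (hy : y ≠ 0) :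
    deriv (fun y => Pinv S x y) y =
      ∑ k, x ^ (S k).1 * (((S k).2 : ℝ) * y ^ ((S k).2 - 1)) :=
  (HasDerivAt.fun_sum fun k _ =>
    (hasDerivAt_zpow (S k).2 y (Or.inl hy)).const_mul (x ^ (S k).1)).deriv

/-- A quadratic with coefficients in `{-1, 0, 1}` that is negative at `1` and nonnegative at some
`x > 0` is one of `1 - x - x ^ 2` and `x ^ 2 - x - 1`, according to the position of `x`. -/
theorem small_quadratic_nonneg {u v w : ℤ} (hu : -1 ≤ u ∧ u ≤ 1) (hv : -1 ≤ v ∧ v ≤ 1)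
    (hw : -1 ≤ w ∧ w ≤ 1) (hsum : u + v + w < 0) {x : ℝ} (hx : 0 < x)
    (h : 0 ≤ (u : ℝ) + v * x + w * x ^ 2) :
    (x < 1 ∧ u = 1 ∧ v = -1 ∧ w = -1) ∨ (1 < x ∧ u = -1 ∧ v = -1 ∧ w = 1) := by
  obtain ⟨hu₁, hu₂⟩ := hu
  obtain ⟨hv₁, hv₂⟩ := hv
  obtain ⟨hw₁, hw₂⟩ := hw
  interval_cases u <;> interval_cases v <;> interval_cases w <;>
    first
    | omega
    | (exfalso; push_cast at h; nlinarith [sq_nonneg (x - 1)])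
    | (push_cast at h; left; refine ⟨?_, rfl, rfl, rfl⟩; nlinarith)
    | (push_cast at h; right; refine ⟨?_, rfl, rfl, rfl⟩; nlinarith)

/-- The critical point equations, cleared of denominators, with the coefficient of `x ^ i * y ^ j`
in the inventory named after the compass direction of `(i, j)`. -/
theorem lt_one_of_crit_equations {ne e se n s nw w sw : ℤ}
    (hne : ne = 0 ∨ ne = 1) (he : e = 0 ∨ e = 1) (hse : se = 0 ∨ se = 1)
    (hn : n = 0 ∨ n = 1) (hs : s = 0 ∨ s = 1) (hnw : nw = 0 ∨ nw = 1)
    (hw : w = 0 ∨ w = 1) (hsw : sw = 0 ∨ sw = 1)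
    (hdrift : ne + n + nw - (se + s + sw) ≤ ne + e + se - (nw + w + sw))
    (hpos : 0 < ne + n + nw - (se + s + sw))
    {x y : ℝ} (hx : 0 < x) (hy : 0 < y)
    (hcx : x ^ 2 * (ne * y ^ 2 + e * y + se) = nw * y ^ 2 + w * y + sw)
    (hcy : y ^ 2 * (ne * x ^ 2 + n * x + nw) = se * x ^ 2 + s * x + sw) :
    x < 1 ∧ y < 1 := by
  have nonneg : ∀ {a : ℤ}, a = 0 ∨ a = 1 → (0 : ℝ) ≤ a := by
    rintro a (rfl | rfl) <;> simp
  have hvert : 1 ≤ y → (x < 1 ∧ sw - nw = 1 ∧ s - n = -1 ∧ se - ne = -1) ∨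
      (1 < x ∧ sw - nw = -1 ∧ s - n = -1 ∧ se - ne = 1) := by
    intro hy1
    apply small_quadratic_nonneg (by omega) (by omega) (by omega) (by omega) hx
    have hC : 0 ≤ ne * x ^ 2 + n * x + nw := by
      have := nonneg hne; have := nonneg hn; have := nonneg hnw
      positivity
    push_cast
    nlinarith [mul_nonneg hC (show 0 ≤ y ^ 2 - 1 by nlinarith)]
  have hhoriz : 1 ≤ x → (y < 1 ∧ sw - se = 1 ∧ w - e = -1 ∧ nw - ne = -1) ∨
      (1 < y ∧ sw - se = -1 ∧ w - e = -1 ∧ nw - ne = 1) := by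
    intro hx1
    apply small_quadratic_nonneg (by omega) (by omega) (by omega) (by omega) hy
    have hA : 0 ≤ ne * y ^ 2 + e * y + se := by
      have := nonneg hne; have := nonneg he; have := nonneg hse
      positivity
    push_cast
    nlinarith [mul_nonneg hA (show 0 ≤ x ^ 2 - 1 by nlinarith)]
  -- For the steps `{NE, N, E, SW}` the critical point is on the diagonal.
  have hdiag : ne = 1 → n = 1 → nw = 0 → e = 1 → w = 0 → s = 0 → se = 0 → sw = 1 →
      x = y := by
    rintro rfl rfl rfl rfl rfl rfl rfl rfl
    push_cast at hcx hcy
    have : x * y * (x - y) = 0 := by linear_combination hcx - hcy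
    have hxy : x * y ≠ 0 := by positivity
    linarith [(mul_eq_zero.mp this).resolve_left hxy]
  rcases lt_or_ge x 1 with hx1 | hx1
  · refine ⟨hx1, ?_⟩
    by_contra! hy1
    rcases hvert hy1 with h | h
    · have := hdiag (by omega) (by omega) (by omega) (by omega) (by omega) (by omega)
        (by omega) (by omega)
      linarith
    · linarith
  · exfalso
    rcases hhoriz hx1 with h | h
    · have := hdiag (by omega) (by omega) (by omega) (by omega) (by omega) (by omega)
        (by omega) (by omega)
      linarith
    · rcases hvert h.1.le with h' | h'
      · linarith
      · obtain ⟨rfl, rfl, rfl, rfl, rfl, rfl, rfl, rfl⟩ : ne = 0 ∧ n = 1 ∧ nw = 1 ∧ e = 1 ∧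
            w = 0 ∧ s = 0 ∧ se = 1 ∧ sw = 0 := by omega
        push_cast at hcx hcy
        nlinarith [mul_pos hx hy, pow_pos hx 2, pow_pos hy 2, mul_pos (pow_pos hy 2) hx,
          mul_pos (pow_pos hx 2) hy]

/-- Let `S ⊆ {−1,0,1}² \ {(0,0)}` define a nontrivial quarter-plane
model with inventory `P` and drift `(δ_x, δ_y) = (P_x(1,1), P_y(1,1))` satisfying
`δ_x ≥ δ_y > 0`. If `(α,β) ∈ (0,∞)²` satisfies `P_x(α,β) = P_y(α,β) = 0`, then
`α < 1` and `β < 1`. -/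
theorem crit_point_lt_one_of_pos_drift {ι : Type} [Fintype ι] (S : ι → ℤ × ℤ)
    (hinj : Function.Injective S)
    (hsmall : ∀ k, (S k).1 ∈ ({-1, 0, 1} : Set ℤ) ∧ (S k).2 ∈ ({-1, 0, 1} : Set ℤ) ∧
      S k ≠ (0, 0))
    (hnt : NontrivialQP S)
    (hdrift : deriv (fun x => Pinv S x 1) 1 ≥ deriv (fun y => Pinv S 1 y) 1 ∧
      0 < deriv (fun y => Pinv S 1 y) 1)
    (α β : ℝ) (hα : 0 < α) (hβ : 0 < β)
    (hcx : deriv (fun x => Pinv S x β) α = 0)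
    (hcy : deriv (fun y => Pinv S α y) β = 0) :
    α < 1 ∧ β < 1 := by
  have hsmall' := fun k => (⟨(hsmall k).1, (hsmall k).2.1⟩ : _ ∧ _)
  rw [deriv_Pinv_fst S one_ne_zero, deriv_Pinv_snd S 1 one_ne_zero,
    sum_steps_eq hinj hsmall' (fun p => (p.1 : ℝ) * 1 ^ (p.1 - 1) * 1 ^ p.2),
    sum_steps_eq hinj hsmall' (fun p => 1 ^ p.1 * ((p.2 : ℝ) * 1 ^ (p.2 - 1)))] at hdrift
  rw [deriv_Pinv_fst S hα.ne',
    sum_steps_eq hinj hsmall' (fun p => (p.1 : ℝ) * α ^ (p.1 - 1) * β ^ p.2)] at hcx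
  rw [deriv_Pinv_snd S α hβ.ne',
    sum_steps_eq hinj hsmall' (fun p => α ^ p.1 * ((p.2 : ℝ) * β ^ (p.2 - 1)))] at hcy
  have hα2 : α ^ (-2 : ℤ) = (α ^ 2)⁻¹ := by norm_cast
  have hβ2 : β ^ (-2 : ℤ) = (β ^ 2)⁻¹ := by norm_cast
  norm_num [hα2, hβ2] at hdrift hcx hcy
  field_simp at hcx hcy
  have hstep := stepInd_eq_zero_or_one S
  obtain ⟨hdrift, hpos⟩ := hdrift
  refine lt_one_of_crit_equations (hstep (1, 1)) (hstep (1, 0)) (hstep (1, -1)) (hstep (0, 1))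
    (hstep (0, -1)) (hstep (-1, 1)) (hstep (-1, 0)) (hstep (-1, -1)) ?_ ?_ hα hβ ?_ ?_
  · rw [← @Int.cast_le ℝ]
    push_cast
    linarith
  · rw [← @Int.cast_lt ℝ]
    push_cast
    linarith
  · linarith
  · linarith
end
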